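/- Let (𝔊,Φ) be a structurally compatible affine cellular automaton of radius 1 on a topological Markov chain 𝔊 which is regular and simple, and suppose moreover that 𝔊 is irreducible and contains a constant sequence (…,g,g,g,…). Then for every shift-invariant probability measure μ on 𝔊 with complete connections (compatible with 𝔊) and summable decay, the Cesàro mean distribution (1/N) ∑_{n=0}^{N−1} μ ∘ Φ^{−n} converges in the weak-* topology to the Parry measure of 𝔊. -/

import Mathlib

open Filter Topology MeasureTheory
open scoped ENNReal

namespace CAStmt

/-- The shift map on bi-infinite sequences. -/
def shiftMap {G : Type*} (x : ℤ → G) : ℤ → G := fun n => x (n + 1)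

/-- The topological Markov chain determined by the transition set `E`. -/
def TMC {G : Type*} (E : Set (G × G)) : Set (ℤ → G) := {x | ∀ i : ℤ, (x i, x (i + 1)) ∈ E}

/-- The word `w` occurs in some point of `X`. -/
def WordIn {G : Type*} (X : Set (ℤ → G)) {m : ℕ} (w : Fin m → G) : Prop :=
  ∃ x ∈ X, ∃ j : ℤ, ∀ i : Fin m, x (j + ((i : ℕ) : ℤ)) = w i

/-- Every letter of the alphabet occurs in some point of the TMC. -/
def EveryLetterOccurs {G : Type*} (E : Set (G × G)) : Prop :=
  ∀ g : G, ∃ x ∈ TMC E, ∃ i : ℤ, x i = g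

/-- The radius-1 cellular automaton map with local rule `φ`. -/
def CA {G : Type*} (φ : G → G → G) (x : ℤ → G) : ℤ → G := fun j => φ (x j) (x (j + 1))

/-- Structural compatibility of the local rule `φ` with the TMC of `E`. -/
def SC {G : Type*} (E : Set (G × G)) (φ : G → G → G) : Prop :=
  ∀ x ∈ TMC E, ∀ y ∈ TMC E, (fun i => φ (x i) (y i)) ∈ TMC E

def RightPerm {G : Type*} (φ : G → G → G) : Prop := ∀ a, Function.Bijective (φ a)

def LeftPerm {G : Type*} (φ : G → G → G) : Prop := ∀ b, Function.Bijective (fun a => φ a b)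

/-- Irreducibility: any two letters are joined by an allowed word `(u,v₁,…,v_k,w)`, `k ≥ 1`. -/
def IrreducibleTMC {G : Type*} (E : Set (G × G)) : Prop :=
  ∀ u w : G, ∃ x ∈ TMC E, ∃ i j : ℤ, i + 1 < j ∧ x i = u ∧ x j = w

/-- Mixing with mixing constant `q`. -/
def MixingTMCWith {G : Type*} (E : Set (G × G)) (q : ℕ) : Prop :=
  1 ≤ q ∧ ∀ k : ℕ, q ≤ k → ∀ u w : G,
    ∃ x ∈ TMC E, ∃ i : ℤ, x i = u ∧ x (i + (k : ℤ) + 1) = w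

def MixingTMC {G : Type*} (E : Set (G × G)) : Prop := ∃ q, MixingTMCWith E q

/-- `Φ` is `N`-scaling on `X`: `(Φ^N x)₀ = φ(x₀, x_N)`. -/
def NScalingOn {G : Type*} (X : Set (ℤ → G)) (φ : G → G → G) (N : ℕ) : Prop :=
  ∀ x ∈ X, (CA φ)^[N] x 0 = φ (x 0) (x (N : ℤ))

/-- The TMC `𝔥(𝔽,τ,n)` over the alphabet `F × Fin n`. -/
def hTMC {F : Type*} (τ : Equiv.Perm F) (n : ℕ) : Set (ℤ → F × Fin n) :=
  TMC {p : (F × Fin n) × (F × Fin n) | p.2.1 = τ p.1.1}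

/-- `op` is a `k`-block operation (memory 0, anticipation `k-1`) closed on `Λ`. -/
def KBlockOp {A : Type*} (Λ : Set (ℤ → A)) (k : ℕ)
    (op : (ℤ → A) → (ℤ → A) → (ℤ → A)) : Prop :=
  (∀ x ∈ Λ, ∀ y ∈ Λ, op x y ∈ Λ) ∧
  ∃ ρ : (Fin k → A) → (Fin k → A) → A,
    ∀ x ∈ Λ, ∀ y ∈ Λ, ∀ j : ℤ,
      op x y j = ρ (fun i => x (j + ((i : ℕ) : ℤ))) (fun i => y (j + ((i : ℕ) : ℤ)))

/-- `op` is a quasigroup operation on `Λ`: all translations are bijections of `Λ`. -/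
def QuasigroupOp {A : Type*} (Λ : Set (ℤ → A)) (op : (ℤ → A) → (ℤ → A) → (ℤ → A)) : Prop :=
  ∀ z ∈ Λ, Set.BijOn (fun x => op x z) Λ Λ ∧ Set.BijOn (fun y => op z y) Λ Λ

/-- A 1-block topological conjugacy between `(X,Φ)` and `(Y,Ψ)` induced by the letter map `θ`. -/
def OneBlockConjugacy {A B : Type*} (X : Set (ℤ → A)) (Φ : (ℤ → A) → (ℤ → A))
    (Y : Set (ℤ → B)) (Ψ : (ℤ → B) → (ℤ → B)) (θ : A → B) : Prop :=
  Set.BijOn (fun x => θ ∘ x) X Y ∧ ∀ x ∈ X, θ ∘ (Φ x) = Ψ (θ ∘ x)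

/-- `add` is an abelian group operation. -/
def IsAbelianGroupOp {K : Type*} (add : K → K → K) : Prop :=
  (∀ a b c, add (add a b) c = add a (add b c)) ∧ (∀ a b, add a b = add b a) ∧
  ∃ z : K, (∀ a, add z a = a) ∧ ∀ a, ∃ b, add a b = z

/-- The product transition set on `K × B`. -/
def prodE {K B : Type*} (EK : Set (K × K)) (EB : Set (B × B)) : Set ((K × B) × (K × B)) :=
  {p | (p.1.1, p.2.1) ∈ EK ∧ (p.1.2, p.2.2) ∈ EB}

/-- `φK` is an affine local rule for the abelian group operation `add`. -/
def IsAffineRuleExpl {K : Type*} (add : K → K → K) (φK : K → K → K) : Prop :=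
  IsAbelianGroupOp add ∧
  ∃ (η ρc : K → K) (c : K), Function.Bijective η ∧ Function.Bijective ρc ∧
    (∀ a b, η (add a b) = add (η a) (η b)) ∧ (∀ a b, ρc (add a b) = add (ρc a) (ρc b)) ∧
    (∀ a, η (ρc a) = ρc (η a)) ∧
    ∀ a b, φK a b = add (add (η a) (ρc b)) c

/-- The cylinder on the word `w` at coordinates `0,…,m-1`. -/
def cyl {A : Type*} {m : ℕ} (w : Fin m → A) : Set (ℤ → A) :=
  {x | ∀ i : Fin m, x ((i : ℕ) : ℤ) = w i}

/-- A past: `p i` is the letter at coordinate `-(i+1)`; all transitions allowed. -/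
def IsPast {A : Type*} (E : Set (A × A)) (p : ℕ → A) : Prop :=
  ∀ i : ℕ, (p (i + 1), p i) ∈ E

/-- The word `(w_{-m},…,w_{-1})` of the past `p`. -/
def pastWord {A : Type*} (p : ℕ → A) (m : ℕ) : Fin m → A :=
  fun j => p (m - 1 - (j : ℕ))

/-- `μ` has complete connections (compatible with the TMC of `E`) and summable decay. -/
def CCSD {A : Type*} [MeasurableSpace A] (E : Set (A × A)) (μ : Measure (ℤ → A)) : Prop :=
  ∃ ν : (ℕ → A) → A → ℝ,
    (∀ p, IsPast E p → ∀ a, (p 0, a) ∈ E →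
      0 < ν p a ∧
      Tendsto (fun m : ℕ =>
          (μ (cyl (Fin.snoc (pastWord p m) a))).toReal / (μ (cyl (pastWord p m))).toReal)
        atTop (nhds (ν p a))) ∧
    ∃ γ : ℕ → ℝ, Summable γ ∧
      ∀ m : ℕ, 1 ≤ m → ∀ p q, IsPast E p → IsPast E q → (∀ i < m, p i = q i) →
        ∀ a, (p 0, a) ∈ E → |ν p a / ν q a - 1| ≤ γ m

/-- A shift-invariant probability measure carried by the TMC of `E`, positive on allowed
cylinders. -/
def GoodMeasure {A : Type*} [MeasurableSpace A] (E : Set (A × A)) (μ : Measure (ℤ → A)) : Prop :=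
  IsProbabilityMeasure μ ∧ Measure.map shiftMap μ = μ ∧ μ (TMC E) = 1 ∧
  ∀ (m : ℕ) (w : Fin m → A), WordIn (TMC E) w → 0 < μ (cyl w)

/-- The identification of `𝔽 × Σ_n` with `𝔥(𝔽,τ,n)`. -/
def ident {F : Type*} (τ : Equiv.Perm F) {n : ℕ} (f : F) (y : ℤ → Fin n) : ℤ → F × Fin n :=
  fun i => ((τ ^ i) f, y i)

/-- A quasigroup operation on an alphabet. -/
def QuasigroupPointOp {K : Type*} (o : K → K → K) : Prop :=
  ∀ a, Function.Bijective (fun x => o x a) ∧ Function.Bijective (o a)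

/-- The data witnessing that an SC bipermutative c.a. is regular and simple. -/
def RegularSimpleData {K F : Type*} (EK : Set (K × K)) (φK : K → K → K)
    (τ : Equiv.Perm F) (n k : ℕ)
    (op : (ℤ → F × Fin n) → (ℤ → F × Fin n) → (ℤ → F × Fin n))
    (θ : K → F × Fin n) (oF : F → F → F) (oS : Fin n → Fin n → Fin n) : Prop :=
  1 ≤ n ∧ 1 ≤ k ∧
  KBlockOp (hTMC τ n) k op ∧ QuasigroupOp (hTMC τ n) op ∧
  OneBlockConjugacy (TMC EK) (CA φK) (hTMC τ n) (fun x => op x (shiftMap x)) θ ∧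
  QuasigroupPointOp oF ∧ QuasigroupPointOp oS ∧
  ∀ (f g : F) (y z : ℤ → Fin n),
    op (ident τ f y) (ident τ g z) = ident τ (oF f g) (fun i => oS (y i) (z i))

/-- An SC bipermutative c.a. is regular and simple. -/
def RegularSimple {K : Type*} (EK : Set (K × K)) (φK : K → K → K) : Prop :=
  ∃ (F : Type) (_ : Fintype F) (τ : Equiv.Perm F) (n k : ℕ)
    (op : (ℤ → F × Fin n) → (ℤ → F × Fin n) → (ℤ → F × Fin n))
    (θ : K → F × Fin n) (oF : F → F → F) (oS : Fin n → Fin n → Fin n),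
    RegularSimpleData EK φK τ n k op θ oF oS

/-- Weak-* convergence of the Cesàro means of `μ` under `Φ` to `κ`. -/
def CesaroTendstoTo {G : Type*} [TopologicalSpace G] [MeasurableSpace G]
    (μ : Measure (ℤ → G)) (Φ : (ℤ → G) → (ℤ → G)) (κ : Measure (ℤ → G)) : Prop :=
  ∀ f : C(ℤ → G, ℝ), Tendsto
    (fun N : ℕ => (N : ℝ)⁻¹ * ∑ n ∈ Finset.range N, ∫ x, f (Φ^[n] x) ∂μ)
    atTop (nhds (∫ x, f x ∂κ))

/-- `κ` is the Parry measure of the irreducible TMC of `E`. -/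
def IsParryMeasure {G : Type*} [Fintype G] [MeasurableSpace G] (E : Set (G × G))
    (κ : Measure (ℤ → G)) : Prop :=
  IsProbabilityMeasure κ ∧ Measure.map shiftMap κ = κ ∧
  ∃ (lam : ℝ) (r l : G → ℝ), 0 < lam ∧ (∀ a, 0 < r a) ∧ (∀ a, 0 < l a) ∧
    (∀ a : G, (∑ b : G, E.indicator (fun _ => r b) (a, b)) = lam * r a) ∧
    (∀ b : G, (∑ a : G, E.indicator (fun _ => l a) (a, b)) = lam * l b) ∧
    (∑ a : G, l a * r a) = 1 ∧
    ∀ (m : ℕ) (w : Fin (m + 1) → G), WordIn (TMC E) w →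
      (κ (cyl w)).toReal = l (w 0) * r (w (Fin.last m)) / lam ^ m

/-- Entropy of the refinement `P ∨ T⁻¹P ∨ ⋯ ∨ T^{-(n-1)}P`. -/
noncomputable def joinEntropy {X : Type*} [MeasurableSpace X] (μ : Measure X) (T : X → X)
    {r : ℕ} (P : Fin r → Set X) (n : ℕ) : ℝ :=
  -∑ c : Fin n → Fin r,
      ((μ (⋂ i : Fin n, T^[(i : ℕ)] ⁻¹' P (c i))).toReal *
        Real.log (μ (⋂ i : Fin n, T^[(i : ℕ)] ⁻¹' P (c i))).toReal)

/-- The Kolmogorov–Sinai entropy `h_μ(T)` is positive: some finite measurable partition has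
positive entropy. -/
def KSEntropyPos {X : Type*} [MeasurableSpace X] (μ : Measure X) (T : X → X) : Prop :=
  ∃ (r : ℕ) (P : Fin r → Set X), (∀ i, MeasurableSet (P i)) ∧
    Pairwise (Function.onFun Disjoint P) ∧ (⋃ i, P i) = Set.univ ∧
    0 < Filter.liminf (fun n : ℕ => joinEntropy μ T P n / n) Filter.atTop

end CAStmt

namespace CAStmt

set_option linter.unusedSectionVars false

/-! ### The group structure of a structurally compatible affine chain -/

theorem equiv_mem_iff_of_finite {A : Type*} [Finite A] {S : Set A} (f : A ≃ A)
    (hf : ∀ a ∈ S, f a ∈ S) (a : A) : f a ∈ S ↔ a ∈ S := by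
  refine ⟨fun h => ?_, hf a⟩
  have hinj : Function.Injective (fun x : S => (⟨f x, hf x x.2⟩ : S)) := fun x y hxy =>
    Subtype.ext (f.injective (congrArg Subtype.val hxy))
  obtain ⟨b, hb⟩ := Finite.surjective_of_injective hinj ⟨f a, h⟩
  have : f b = f a := congrArg Subtype.val hb
  rw [← f.injective this]
  exact b.2

theorem sub_add_mem_of_affine_closed {A : Type*} [AddCommGroup A] [Finite A] {S : Set A}
    (η ρ : A ≃+ A) (c : A) (hS : ∀ e ∈ S, ∀ e' ∈ S, η e + ρ e' + c ∈ S)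
    {e₁ e₂ t : A} (h₁ : e₁ ∈ S) (h₂ : e₂ ∈ S) (ht : t ∈ S) : η (e₁ - e₂) + t ∈ S := by
  have hinj : Function.Injective (fun x : S => (⟨η e₂ + ρ x + c, hS _ h₂ x x.2⟩ : S)) := by
    intro x y hxy
    have h : η e₂ + ρ x + c = η e₂ + ρ y + c := congrArg Subtype.val hxy
    exact Subtype.ext (ρ.injective (add_left_cancel (add_right_cancel h)))
  obtain ⟨e', he'⟩ := Finite.surjective_of_injective hinj ⟨t, ht⟩
  have h : η e₂ + ρ e' + c = t := congrArg Subtype.val he'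
  have : η (e₁ - e₂) + t = η e₁ + ρ e' + c := by rw [← h, map_sub]; abel
  rw [this]
  exact hS _ h₁ _ e'.2

/-- A finite set closed under an affine operation is a coset of a subgroup invariant under both
automorphisms. -/
theorem exists_subgroup_of_affine_closed {A : Type*} [AddCommGroup A] [Finite A] {S : Set A}
    (η ρ : A ≃+ A) (c : A) (hS : ∀ e ∈ S, ∀ e' ∈ S, η e + ρ e' + c ∈ S) {z : A} (hz : z ∈ S) :
    ∃ K : AddSubgroup A, (∀ a, a ∈ K ↔ z + a ∈ S) ∧ (∀ a, η a ∈ K ↔ a ∈ K) ∧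
      ∀ a, ρ a ∈ K ↔ a ∈ K := by
  have key : ∀ {e₁ e₂ t : A}, e₁ ∈ S → e₂ ∈ S → t ∈ S → η (e₁ - e₂) + t ∈ S :=
    sub_add_mem_of_affine_closed η ρ c hS
  have key' : ∀ {e₁ e₂ t : A}, e₁ ∈ S → e₂ ∈ S → t ∈ S → ρ (e₁ - e₂) + t ∈ S :=
    sub_add_mem_of_affine_closed ρ η c fun e he e' he' => by
      rw [add_comm (ρ e)]; exact hS _ he' _ he
  have hinj : Function.Injective (fun x : S => (⟨η (x - z) + z, key x.2 hz hz⟩ : S)) := by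
    intro x y hxy
    have h : η (x - z) + z = η (y - z) + z := congrArg Subtype.val hxy
    exact Subtype.ext (sub_left_injective (η.injective (add_right_cancel h)))
  have hsurj : ∀ s ∈ S, ∃ e ∈ S, η (e - z) + z = s := fun s hs => by
    obtain ⟨e, he⟩ := Finite.surjective_of_injective hinj ⟨s, hs⟩
    exact ⟨e, e.2, congrArg Subtype.val he⟩
  let K : AddSubgroup A :=
    { carrier := {a | z + a ∈ S}
      zero_mem' := by simpa using hz
      add_mem' := by
        intro a b ha hb
        obtain ⟨e, he, hea⟩ := hsurj _ ha
        have h : z + (a + b) = η (e - z) + (z + b) := by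
          have : a = η (e - z) := by rw [add_comm] at hea; exact (add_left_cancel hea).symm
          rw [this]; abel
        change z + (a + b) ∈ S
        rw [h]
        exact key he hz hb
      neg_mem' := by
        intro a ha
        obtain ⟨e, he, hea⟩ := hsurj _ ha
        have h : z + -a = η (z - e) + z := by
          have : a = η (e - z) := by rw [add_comm] at hea; exact (add_left_cancel hea).symm
          rw [this, ← map_neg, neg_sub]; abel
        change z + -a ∈ S
        rw [h]
        exact key hz he hz }
  refine ⟨K, fun a => Iff.rfl, fun a => ?_, fun a => ?_⟩
  · refine equiv_mem_iff_of_finite (S := (K : Set A)) η.toEquiv (fun b hb => ?_) a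
    have := key (show z + b ∈ S from hb) hz hz
    rw [add_sub_cancel_left, add_comm] at this
    exact this
  · refine equiv_mem_iff_of_finite (S := (K : Set A)) ρ.toEquiv (fun b hb => ?_) a
    have := key' (show z + b ∈ S from hb) hz hz
    rw [add_sub_cancel_left, add_comm] at this
    exact this

theorem TMC_shift {G : Type*} {E : Set (G × G)} {x : ℤ → G} (hx : x ∈ TMC E) (k : ℤ) :
    (fun i => x (i + k)) ∈ TMC E := fun i => by
  have := hx (i + k)
  rwa [show i + k + 1 = i + 1 + k by ring] at this

/-- Gluing a left half and a right half of two points along a common transition. -/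
theorem exists_TMC_of_edge {G : Type*} {E : Set (G × G)} (hE : EveryLetterOccurs E) {a b : G}
    (hab : (a, b) ∈ E) : ∃ x ∈ TMC E, x 0 = a ∧ x 1 = b := by
  obtain ⟨y, hy, i, hi⟩ := hE a
  obtain ⟨z, hz, j, hj⟩ := hE b
  refine ⟨fun k => if k ≤ 0 then y (k + i) else z (k + (j - 1)), fun k => ?_, by simp [hi],
    by simp [hj]⟩
  rcases lt_trichotomy k 0 with h | rfl | h
  · have h1 : k ≤ 0 := h.le
    have h2 : k + 1 ≤ 0 := h
    simp only [h1, h2, if_true]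
    exact TMC_shift hy i k
  · simpa [hi, hj] using hab
  · have h1 : ¬ k ≤ 0 := by omega
    have h2 : ¬ k + 1 ≤ 0 := by omega
    simp only [h1, h2, if_false]
    exact TMC_shift hz (j - 1) k

/-- The subgroup shift of all paths in the transition subgroup `K`. -/
def pathSubgroup {G : Type*} [AddCommGroup G] (K : AddSubgroup (G × G)) :
    AddSubgroup (ℤ → G) where
  carrier := {h | ∀ i, (h i, h (i + 1)) ∈ K}
  zero_mem' := fun _ => K.zero_mem
  add_mem' := fun ha hb i => K.add_mem (ha i) (hb i)
  neg_mem' := fun ha i => K.neg_mem (ha i)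

theorem mem_pathSubgroup {G : Type*} [AddCommGroup G] {K : AddSubgroup (G × G)} {h : ℤ → G} :
    h ∈ pathSubgroup K ↔ ∀ i, (h i, h (i + 1)) ∈ K := Iff.rfl

/-- The transition set of a structurally compatible affine automaton is a coset of a subgroup. -/
theorem exists_edge_subgroup {G : Type*} [Finite G] [AddCommGroup G] {E : Set (G × G)}
    (hE : EveryLetterOccurs E) {φ : G → G → G} (hSC : SC E φ) (η ρ : G ≃+ G) (c : G)
    (hφ : ∀ a b, φ a b = η a + ρ b + c) {g : G} (hg : (g, g) ∈ E) :
    ∃ K : AddSubgroup (G × G), (∀ a b, (a, b) ∈ K ↔ (g + a, g + b) ∈ E) ∧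
      (∀ a b, (η a, η b) ∈ K ↔ (a, b) ∈ K) ∧ ∀ a b, (ρ a, ρ b) ∈ K ↔ (a, b) ∈ K := by
  obtain ⟨K, h₁, h₂, h₃⟩ := exists_subgroup_of_affine_closed (S := E) (η.prodCongr η)
    (ρ.prodCongr ρ) (c, c) (by
      rintro ⟨a, b⟩ he ⟨a', b'⟩ he'
      obtain ⟨x, hx, rfl, rfl⟩ := exists_TMC_of_edge hE he
      obtain ⟨y, hy, rfl, rfl⟩ := exists_TMC_of_edge hE he'
      have := hSC x hx y hy 0
      simp only [hφ] at this
      exact this) hg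
  exact ⟨K, fun a b => h₁ (a, b), fun a b => h₂ (a, b), fun a b => h₃ (a, b)⟩

/-! ### Truncating paths to finite support -/

/-- Every letter reaches `0`, and is reached from `0`, along a path of length at most `q`. -/
def ConnectsToZero {G : Type*} [AddCommGroup G] (K : AddSubgroup (G × G)) (q : ℕ) : Prop :=
  (∀ u : G, ∃ z : ℕ → G, z 0 = u ∧ (∀ k, (z k, z (k + 1)) ∈ K) ∧ ∀ k, q ≤ k → z k = 0) ∧
    ∀ u : G, ∃ z : ℕ → G, z 0 = u ∧ (∀ k, (z (k + 1), z k) ∈ K) ∧ ∀ k, q ≤ k → z k = 0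

theorem exists_connectsToZero {G : Type*} [Finite G] [AddCommGroup G] {E : Set (G × G)}
    (hirr : IrreducibleTMC E) {g : G} (hg : (g, g) ∈ E) {K : AddSubgroup (G × G)}
    (hK : ∀ a b, (a, b) ∈ K ↔ (g + a, g + b) ∈ E) : ∃ q, ConnectsToZero K q := by
  have hR : ∀ u : G, ∃ q : ℕ, ∃ z : ℕ → G, z 0 = u ∧ (∀ k, (z k, z (k + 1)) ∈ K) ∧
      ∀ k, q ≤ k → z k = 0 := fun u => by
    obtain ⟨x, hx, i, j, hij, hi, hj⟩ := hirr (g + u) g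
    refine ⟨(j - i).toNat, fun k => if i + k ≤ j then x (i + k) - g else 0, ?_, fun k => ?_,
      fun k hk => ?_⟩
    · have : i ≤ j := by omega
      simp [this, hi]
    · rw [hK]
      rcases lt_trichotomy (i + k) j with h | h | h
      · have h1 : i + (k : ℤ) ≤ j := h.le
        have h2 : i + ((k + 1 : ℕ) : ℤ) ≤ j := by push_cast; omega
        simp only [h1, h2, if_true, add_sub_cancel]
        have := hx (i + k)
        rwa [add_assoc] at this
      · have h1 : i + (k : ℤ) ≤ j := h.le
        have h2 : ¬ i + ((k + 1 : ℕ) : ℤ) ≤ j := by push_cast; omega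
        dsimp only
        rw [if_pos h1, if_neg h2, h, hj]
        simpa using hg
      · have h1 : ¬ i + (k : ℤ) ≤ j := by omega
        have h2 : ¬ i + ((k + 1 : ℕ) : ℤ) ≤ j := by push_cast; omega
        simpa only [h1, h2, if_false, add_zero] using hg
    · by_cases h : i + (k : ℤ) ≤ j
      · have : i + (k : ℤ) = j := by omega
        simp [this, hj]
      · simp [h]
  have hL : ∀ u : G, ∃ q : ℕ, ∃ z : ℕ → G, z 0 = u ∧ (∀ k, (z (k + 1), z k) ∈ K) ∧
      ∀ k, q ≤ k → z k = 0 := fun u => by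
    obtain ⟨x, hx, i, j, hij, hi, hj⟩ := hirr g (g + u)
    refine ⟨(j - i).toNat, fun k => if i ≤ j - k then x (j - k) - g else 0, ?_, fun k => ?_,
      fun k hk => ?_⟩
    · have : i ≤ j := by omega
      simp [this, hj]
    · rw [hK]
      rcases lt_trichotomy i (j - k) with h | h | h
      · have h1 : i ≤ j - (k : ℤ) := h.le
        have h2 : i ≤ j - ((k + 1 : ℕ) : ℤ) := by push_cast; omega
        simp only [h1, h2, if_true, add_sub_cancel]
        have := hx (j - ((k + 1 : ℕ) : ℤ))
        rwa [show j - ((k + 1 : ℕ) : ℤ) + 1 = j - k by push_cast; ring] at this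
      · have h1 : i ≤ j - (k : ℤ) := h.le
        have h2 : ¬ i ≤ j - ((k + 1 : ℕ) : ℤ) := by push_cast; omega
        dsimp only
        rw [if_pos h1, if_neg h2, ← h, hi]
        simpa using hg
      · have h1 : ¬ i ≤ j - (k : ℤ) := by omega
        have h2 : ¬ i ≤ j - ((k + 1 : ℕ) : ℤ) := by push_cast; omega
        simpa only [h1, h2, if_false, add_zero] using hg
    · by_cases h : i ≤ j - (k : ℤ)
      · have : j - (k : ℤ) = i := by omega
        simp [this, hi]
      · simp [h]
  choose qR hR using hR
  choose qL hL using hL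
  obtain ⟨M, hM⟩ := (Set.finite_range qR).bddAbove
  obtain ⟨M', hM'⟩ := (Set.finite_range qL).bddAbove
  refine ⟨max M M', fun u => ?_, fun u => ?_⟩
  · obtain ⟨z, h0, h1, h2⟩ := hR u
    exact ⟨z, h0, h1, fun k hk => h2 k
      ((hM ⟨u, rfl⟩).trans ((le_max_left _ _).trans hk))⟩
  · obtain ⟨z, h0, h1, h2⟩ := hL u
    exact ⟨z, h0, h1, fun k hk => h2 k
      ((hM' ⟨u, rfl⟩).trans ((le_max_right _ _).trans hk))⟩

theorem exists_truncation {G : Type*} [AddCommGroup G] {K : AddSubgroup (G × G)} {q : ℕ}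
    (hq : ConnectsToZero K q) {h : ℤ → G} (hh : h ∈ pathSubgroup K) {a b : ℤ} (hab : a < b) :
    ∃ h' ∈ pathSubgroup K, (∀ i, a ≤ i → i < b → h' i = h i) ∧
      ∀ i, i < a - q ∨ b + q ≤ i → h' i = 0 := by
  obtain ⟨zR, hR0, hR, hRq⟩ := hq.1 (h (b - 1))
  obtain ⟨zL, hL0, hL, hLq⟩ := hq.2 (h a)
  refine ⟨fun i => if i < a then zL (a - i).toNat else if i < b then h i
    else zR (i - (b - 1)).toNat, fun i => ?_, fun i h1 h2 => ?_, fun i hi => ?_⟩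
  · dsimp only
    by_cases h1 : i < a
    · rw [if_pos h1]
      have e : (a - i).toNat = (a - (i + 1)).toNat + 1 := by omega
      have := hL (a - (i + 1)).toNat
      rw [← e] at this
      by_cases h2 : i + 1 < a
      · rwa [if_pos h2]
      · have e2 : i + 1 = a := by omega
        rw [if_neg h2, if_pos (by omega)]
        rw [e2, sub_self, Int.toNat_zero, hL0] at this
        rwa [e2]
    · rw [if_neg h1, if_neg (show ¬ i + 1 < a by omega)]
      by_cases h2 : i + 1 < b
      · rw [if_pos h2, if_pos (by omega)]
        exact hh i
      · rw [if_neg h2]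
        by_cases h3 : i < b
        · have e : b - 1 = i := by omega
          rw [if_pos h3, e]
          have := hR 0
          rw [hR0, e] at this
          simpa using this
        · rw [if_neg h3]
          have := hR (i - (b - 1)).toNat
          rwa [show (i - (b - 1)).toNat + 1 = (i + 1 - (b - 1)).toNat by omega] at this
  · dsimp only
    rw [if_neg (by omega), if_pos h2]
  · dsimp only
    rcases hi with hi | hi
    · rw [if_pos (by omega)]
      exact hLq _ (by omega)
    · rw [if_neg (by omega), if_neg (by omega)]
      exact hRq _ (by omega)

/-! ### Linear automata on a path subgroup -/

theorem End_mul_apply {M : Type*} [AddCommMonoid M] (f g : AddMonoid.End M) (x : M) :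
    (f * g) x = f (g x) := rfl

theorem End_add_apply {M : Type*} [AddCommMonoid M] (f g : AddMonoid.End M) (x : M) :
    (f + g) x = f x + g x := rfl

theorem End_nsmul_apply {M : Type*} [AddCommMonoid M] (n : ℕ) (f : AddMonoid.End M) (x : M) :
    (n • f) x = n • f x := rfl

theorem End_sum_apply {M ι : Type*} [AddCommMonoid M] (s : Finset ι)
    (f : ι → AddMonoid.End M) (x : M) : (∑ i ∈ s, f i) x = ∑ i ∈ s, f i x :=
  AddMonoidHom.finsetSum_apply f s x

section LinearAutomaton

variable {G : Type*} [AddCommGroup G] {K : AddSubgroup (G × G)}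

/-- A letterwise automorphism acting on the path subgroup. -/
def letterEnd (α : G ≃+ G) (hα : ∀ a b, (α a, α b) ∈ K ↔ (a, b) ∈ K) :
    AddMonoid.End (pathSubgroup K) where
  toFun h := ⟨fun i => α (h.1 i), fun i => (hα _ _).mpr (h.2 i)⟩
  map_zero' := by ext i; simp
  map_add' a b := by ext i; simp

/-- The composition of the shift with a letterwise automorphism acting on the path subgroup. -/
def letterShiftEnd (α : G ≃+ G) (hα : ∀ a b, (α a, α b) ∈ K ↔ (a, b) ∈ K) :
    AddMonoid.End (pathSubgroup K) where
  toFun h := ⟨fun i => α (h.1 (i + 1)), fun i => (hα _ _).mpr (h.2 (i + 1))⟩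
  map_zero' := by ext i; simp
  map_add' a b := by ext i; simp

variable (η ρ : G ≃+ G) (hη : ∀ a b, (η a, η b) ∈ K ↔ (a, b) ∈ K)
  (hρ : ∀ a b, (ρ a, ρ b) ∈ K ↔ (a, b) ∈ K)

theorem commute_letterEnd (hcomm : ∀ a, η (ρ a) = ρ (η a)) :
    Commute (letterEnd η hη) (letterShiftEnd ρ hρ) := by
  ext h i
  exact hcomm _

theorem letterEnd_surjective : Function.Surjective (letterEnd η hη) := fun h =>
  ⟨⟨fun i => η.symm (h.1 i), fun i => (hη _ _).mp (by simpa using h.2 i)⟩, by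
    ext i
    exact η.apply_symm_apply _⟩

theorem letterShiftEnd_surjective : Function.Surjective (letterShiftEnd ρ hρ) := fun h =>
  ⟨⟨fun i => ρ.symm (h.1 (i - 1)), fun i => (hρ _ _).mp (by
      have := h.2 (i - 1)
      rw [sub_add_cancel] at this
      simpa using this)⟩, by
    ext i
    exact (ρ.apply_symm_apply _).trans (by rw [add_sub_cancel_right])⟩

theorem End_pow_surjective {M : Type*} [AddCommMonoid M] {f : AddMonoid.End M}
    (hf : Function.Surjective f) (n : ℕ) : Function.Surjective (f ^ n : AddMonoid.End M) := by
  rw [AddMonoid.End.coe_pow]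
  exact hf.iterate n

theorem letterEnd_pow_apply_eq_zero (n : ℕ) (h : pathSubgroup K) (i : ℤ) :
    ((letterEnd η hη ^ n) h).1 i = 0 ↔ h.1 i = 0 := by
  induction n generalizing h with
  | zero => rfl
  | succ n ih =>
    rw [pow_succ, End_mul_apply, ih]
    exact map_eq_zero_iff η η.injective

theorem letterShiftEnd_pow_apply_eq_zero (n : ℕ) (h : pathSubgroup K) (i : ℤ) :
    ((letterShiftEnd ρ hρ ^ n) h).1 i = 0 ↔ h.1 (i + n) = 0 := by
  induction n generalizing h with
  | zero => simp
  | succ n ih =>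
    rw [pow_succ, End_mul_apply, ih]
    refine (map_eq_zero_iff ρ ρ.injective).trans ?_
    rw [Nat.cast_succ, add_assoc]

theorem exists_letterEnd_pow_eq_one [Finite G] : ∃ N, 0 < N ∧ letterEnd η hη ^ N = 1 := by
  obtain ⟨N, hN, h⟩ := (isOfFinOrder_of_finite (η.toEquiv : Equiv.Perm G)).exists_pow_eq_one
  refine ⟨N, hN, ?_⟩
  have key : ∀ (n : ℕ) (x : pathSubgroup K) (i : ℤ),
      ((letterEnd η hη ^ n) x).1 i = ((η.toEquiv : Equiv.Perm G) ^ n) (x.1 i) := by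
    intro n
    induction n with
    | zero => intro x i; rfl
    | succ n ih =>
      intro x i
      rw [pow_succ, End_mul_apply, ih, pow_succ, Equiv.Perm.mul_apply]
      rfl
  ext x i
  rw [key, h]
  rfl

/-- The linear part of an affine automaton acting on the path subgroup. -/
def linEnd : AddMonoid.End (pathSubgroup K) := letterEnd η hη + letterShiftEnd ρ hρ

theorem linEnd_apply (h : pathSubgroup K) (i : ℤ) :
    (linEnd η ρ hη hρ h).1 i = η (h.1 i) + ρ (h.1 (i + 1)) := rfl

/-- `ψ` vanishes on the paths which are zero on `[a, b)`. -/
def DependsOn {T : Type*} [AddCommGroup T] (ψ : pathSubgroup K →+ T) (a b : ℤ) : Prop :=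
  ∀ h : pathSubgroup K, (∀ i, a ≤ i → i < b → h.1 i = 0) → ψ h = 0

theorem DependsOn.exists_truncation {T : Type*} [AddCommGroup T] {ψ : pathSubgroup K →+ T}
    {a b : ℤ} (hψ : DependsOn ψ a b) (hab : a < b) {q : ℕ} (hq : ConnectsToZero K q)
    (hne : ψ ≠ 0) :
    ∃ h : pathSubgroup K, ψ h ≠ 0 ∧ ∀ i, h.1 i ≠ 0 → a - q ≤ i ∧ i < b + q := by
  obtain ⟨h, hh⟩ := DFunLike.ne_iff.mp hne
  obtain ⟨h', hmem, heq, hz⟩ := CAStmt.exists_truncation hq h.2 hab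
  refine ⟨⟨h', hmem⟩, fun h0 => hh ?_, fun i hi => ?_⟩
  · have := hψ (h - ⟨h', hmem⟩) fun i h1 h2 => by simp [heq i h1 h2]
    rw [map_sub, h0, sub_zero] at this
    rw [this]; rfl
  · by_contra hcon
    exact hi (hz i (by omega))

theorem comp_linEnd_ne_zero [Finite G] {T : Type*} [AddCommGroup T] {ψ : pathSubgroup K →+ T}
    {a b : ℤ} (hψ : DependsOn ψ a b) (hab : a < b) {q : ℕ} (hq : ConnectsToZero K q)
    (hcomm : ∀ a, η (ρ a) = ρ (η a)) (hne : ψ ≠ 0) : ψ.comp (linEnd η ρ hη hρ) ≠ 0 := by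
  intro hzero
  obtain ⟨h, hh, hsupp⟩ := hψ.exists_truncation hab hq hne
  obtain ⟨N, hN, hA⟩ := exists_letterEnd_pow_eq_one η hη
  have hC := commute_letterEnd η ρ hη hρ hcomm
  have h1 : ∀ x, ψ (letterShiftEnd ρ hρ x) = - ψ (letterEnd η hη x) := fun x => by
    have : ψ (linEnd η ρ hη hρ x) = 0 := DFunLike.congr_fun hzero x
    rw [linEnd, End_add_apply, map_add] at this
    exact eq_neg_of_add_eq_zero_right this
  have h2 : ∀ (n : ℕ) x, ψ ((letterShiftEnd ρ hρ ^ n) x) =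
      (-1 : ℤ) ^ n • ψ ((letterEnd η hη ^ n) x) := by
    intro n
    induction n with
    | zero => intro x; simp
    | succ n ih =>
      intro x
      have e : letterEnd η hη ((letterShiftEnd ρ hρ ^ n) x) =
          (letterShiftEnd ρ hρ ^ n) (letterEnd η hη x) := by
        rw [← End_mul_apply, ← End_mul_apply, (hC.pow_right n).eq]
      rw [pow_succ', End_mul_apply, h1, e, ih, pow_succ, pow_succ,
        End_mul_apply, mul_neg_one, neg_smul]
  set M : ℕ := (b + q - a).toNat
  have h3 := h2 (N * (2 * M)) h
  rw [pow_mul (letterEnd η hη) N, hA, one_pow, mul_left_comm, pow_mul (-1 : ℤ) 2, neg_one_sq, one_pow, one_smul] at h3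
  refine hh (h3.symm.trans (hψ _ fun i hi _ => ?_))
  rw [letterShiftEnd_pow_apply_eq_zero]
  by_contra hcon
  have h4 := (hsupp _ hcon).2
  have h5 : M ≤ 2 * (N * M) := by nlinarith
  have h6 : b + q - a ≤ M := Int.self_le_toNat _
  have h7 : (M : ℤ) ≤ ((2 * (N * M) : ℕ) : ℤ) := by exact_mod_cast h5
  omega

theorem DependsOn.comp_linEnd_pow {T : Type*} [AddCommGroup T] {ψ : pathSubgroup K →+ T}
    {a b : ℤ} (hψ : DependsOn ψ a b) (n : ℕ) :
    DependsOn (ψ.comp (linEnd η ρ hη hρ ^ n : AddMonoid.End (pathSubgroup K))) a (b + n) := by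
  induction n with
  | zero =>
    intro h hz
    exact hψ h fun i h1 h2 => hz i h1 (by simpa using h2)
  | succ n ih =>
    intro h hz
    have := ih (linEnd η ρ hη hρ h) fun i h1 h2 => by
      rw [linEnd_apply, hz i h1 (by push_cast; omega), hz (i + 1) (by omega) (by push_cast; omega),
        map_zero, map_zero, add_zero]
    rwa [pow_succ]

theorem comp_linEnd_pow_ne_zero [Finite G] {T : Type*} [AddCommGroup T]
    {ψ : pathSubgroup K →+ T} {a b : ℤ} (hψ : DependsOn ψ a b) (hab : a < b) {q : ℕ}
    (hq : ConnectsToZero K q) (hcomm : ∀ a, η (ρ a) = ρ (η a)) (hne : ψ ≠ 0) (n : ℕ) :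
    ψ.comp (linEnd η ρ hη hρ ^ n : AddMonoid.End (pathSubgroup K)) ≠ 0 := by
  induction n with
  | zero => exact hne
  | succ n ih =>
    have := comp_linEnd_ne_zero η ρ hη hρ (hψ.comp_linEnd_pow η ρ hη hρ n) (by omega) hq hcomm ih
    rwa [pow_succ]

theorem exists_add_nsmul_pow {R : Type*} [Ring R] {x y z : R} {p : ℕ} (h : x = y + p • z)
    (n : ℕ) : ∃ w : R, x ^ n = y ^ n + p • w := by
  induction n with
  | zero => exact ⟨0, by simp⟩
  | succ n ih =>
    obtain ⟨w, hw⟩ := ih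
    refine ⟨y ^ n * z + w * y + w * (p • z), ?_⟩
    rw [pow_succ, pow_succ, hw, h]
    simp only [mul_add, add_mul, smul_add, smul_mul_assoc, mul_smul_comm]
    abel

/-- A nontrivial character of prime order composed with a power of the linear automaton acts on
the block of index `k` whenever the corresponding binomial coefficient is prime to `p`. -/
theorem exists_block_of_prime [Finite G] {T : Type*} [AddCommGroup T]
    {ψ : pathSubgroup K →+ T} {a b : ℤ} (hψ : DependsOn ψ a b) (hab : a < b) {q : ℕ}
    (hq : ConnectsToZero K q) (hcomm : ∀ a, η (ρ a) = ρ (η a)) (hne : ψ ≠ 0) {p : ℕ}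
    (hp : p.Prime) (hpψ : p • ψ = 0) {s m n k : ℕ} (hm : b - a + 2 * q + m ≤ (p ^ s : ℕ))
    (hk : ¬ p ∣ n.choose k) :
    ∃ h : pathSubgroup K,
      (∀ i, h.1 i ≠ 0 → (p ^ s : ℕ) * (k : ℤ) + (a - q) ≤ i ∧
        i < (p ^ s : ℕ) * (k : ℤ) + (a - q) + (p ^ s : ℕ)) ∧
      ψ ((linEnd η ρ hη hρ ^ (m + p ^ s * n)) h) ≠ 0 := by
  set P := p ^ s
  set L := linEnd η ρ hη hρ
  set A := letterEnd η hη
  set B := letterShiftEnd ρ hρ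
  have hC : Commute A B := commute_letterEnd η ρ hη hρ hcomm
  have hkn : k ≤ n := by
    by_contra hcon
    exact hk (by rw [Nat.choose_eq_zero_of_lt (by omega)]; exact dvd_zero p)
  set ψ₁ : pathSubgroup K →+ T := ψ.comp (L ^ m : AddMonoid.End (pathSubgroup K)) with hψ₁
  have hdep : DependsOn ψ₁ a (b + m) := hψ.comp_linEnd_pow η ρ hη hρ m
  obtain ⟨h₀, hh₀, hsupp⟩ := hdep.exists_truncation (by omega) hq
    (comp_linEnd_pow_ne_zero η ρ hη hρ hψ hab hq hcomm hne m)
  have hp₁ : ∀ x, p • ψ₁ x = 0 := fun x => DFunLike.congr_fun hpψ ((L ^ m) x)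
  obtain ⟨z, hz⟩ := hC.symm.exists_add_pow_prime_pow_eq hp s
  have hLP : L ^ P = (B ^ P + A ^ P) + p • (B * A * z) := by
    change (A + B) ^ P = _
    rw [add_comm A B, hz, nsmul_eq_mul, mul_assoc, mul_assoc, mul_assoc]
  obtain ⟨w, hw⟩ := exists_add_nsmul_pow hLP n
  obtain ⟨h, hh⟩ : ∃ h, ((B ^ P) ^ k * (A ^ P) ^ (n - k)) h = h₀ := by
    obtain ⟨x, hx⟩ := End_pow_surjective
      (End_pow_surjective (letterShiftEnd_surjective ρ hρ) P) k h₀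
    obtain ⟨y, hy⟩ := End_pow_surjective
      (End_pow_surjective (letterEnd_surjective η hη) P) (n - k) x
    exact ⟨y, by rw [End_mul_apply]; exact (congrArg _ hy).trans hx⟩
  have hvan : ∀ (j : ℕ) (i : ℤ), (((B ^ P) ^ j * (A ^ P) ^ (n - j)) h).1 i = 0 ↔
      h.1 (i + (P * j : ℕ)) = 0 := fun j i => by
    rw [← pow_mul, ← pow_mul, End_mul_apply]
    exact (letterShiftEnd_pow_apply_eq_zero ρ hρ _ _ _).trans (letterEnd_pow_apply_eq_zero η hη _ _ _)
  have hsupp' : ∀ i, h.1 i ≠ 0 → P * (k : ℤ) + (a - q) ≤ i ∧ i < P * (k : ℤ) + (b + m + q) := by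
    intro i hi
    have h1 : h₀.1 (i - (P * k : ℕ)) ≠ 0 := by
      rw [← hh, Ne, hvan, sub_add_cancel]
      exact hi
    have := hsupp _ h1
    push_cast at this
    constructor <;> linarith [this.1, this.2]
  refine ⟨h, fun i hi => ⟨(hsupp' i hi).1, by linarith [(hsupp' i hi).2]⟩, ?_⟩
  have hval : ψ ((L ^ (m + P * n)) h) = n.choose k • ψ₁ h₀ := by
    have e1 : ψ ((L ^ (m + P * n)) h) = ψ₁ ((L ^ P) ^ n • h) := by
      rw [pow_add, pow_mul]; rfl
    have e2 : ψ₁ ((p • w : AddMonoid.End (pathSubgroup K)) h) = 0 := by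
      rw [End_nsmul_apply, map_nsmul, hp₁]
    have hC' : Commute (B ^ P) (A ^ P) := hC.symm.pow_pow P P
    have e3 : ψ₁ ((L ^ P) ^ n • h) = ∑ j ∈ Finset.range (n + 1),
        n.choose j • ψ₁ (((B ^ P) ^ j * (A ^ P) ^ (n - j)) h) := by
      change ψ₁ (((L ^ P) ^ n) h) = _
      rw [hw, End_add_apply, map_add, e2, add_zero, hC'.add_pow,
        End_sum_apply, map_sum]
      refine Finset.sum_congr rfl fun j _ => ?_
      rw [← nsmul_eq_mul', End_nsmul_apply, map_nsmul]
    rw [e1, e3, Finset.sum_eq_single k, hh]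
    · intro j _ hjk
      rw [hdep _ fun i h1 h2 => ?_, smul_zero]
      rw [hvan]
      by_contra hcon
      have h3 := hsupp' _ hcon
      push_cast at h3
      have hP : (0 : ℤ) ≤ P := Int.natCast_nonneg _
      rcases lt_or_gt_of_ne hjk with hlt | hgt
      · have : (j : ℤ) + 1 ≤ k := by exact_mod_cast hlt
        nlinarith [h3.1]
      · have : (k : ℤ) + 1 ≤ j := by exact_mod_cast hgt
        nlinarith [h3.2]
    · intro hcon
      exact absurd (Finset.mem_range.mpr (by omega)) hcon
  rw [hval]
  intro hcon
  have h1 : addOrderOf (ψ₁ h₀) ∣ n.choose k := addOrderOf_dvd_of_nsmul_eq_zero hcon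
  have h2 : addOrderOf (ψ₁ h₀) ∣ p := addOrderOf_dvd_of_nsmul_eq_zero (hp₁ h₀)
  rcases (Nat.dvd_prime hp).mp h2 with h3 | h3
  · exact hh₀ (AddMonoid.addOrderOf_eq_one_iff.mp h3)
  · exact hk (h3 ▸ h1)

theorem exists_nsmul_prime_order {A : Type*} [AddMonoid A] {x : A} (hx : x ≠ 0) {N : ℕ}
    (hN : 0 < N) (hNx : N • x = 0) : ∃ p m : ℕ, p.Prime ∧ m • x ≠ 0 ∧ p • m • x = 0 := by
  have hd : 0 < addOrderOf x := addOrderOf_pos_iff.mpr (isOfFinAddOrder_iff_nsmul_eq_zero.mpr ⟨N, hN, hNx⟩)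
  have hd1 : addOrderOf x ≠ 1 := fun h => hx (AddMonoid.addOrderOf_eq_one_iff.mp h)
  have hp := Nat.minFac_prime hd1
  obtain ⟨m, hm⟩ := Nat.minFac_dvd (addOrderOf x)
  have hm0 : 0 < m := Nat.pos_of_ne_zero (by rintro rfl; omega)
  refine ⟨_, m, hp, fun h => ?_, ?_⟩
  · have := Nat.le_of_dvd hm0 (addOrderOf_dvd_of_nsmul_eq_zero h)
    have := hp.two_le
    nlinarith
  · rw [← mul_nsmul', ← hm, addOrderOf_nsmul_eq_zero]

/-- A nontrivial character composed with a power of the linear automaton acts on the block of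
index `k` whenever the corresponding binomial coefficient is prime to a suitable `p`. -/
theorem exists_block [Finite G] {T : Type*} [AddCommGroup T]
    {χ : pathSubgroup K →+ T} {a b : ℤ} (hχ : DependsOn χ a b) (hab : a < b) {q : ℕ}
    (hq : ConnectsToZero K q) (hcomm : ∀ a, η (ρ a) = ρ (η a)) (hne : χ ≠ 0) :
    ∃ p : ℕ, p.Prime ∧ ∀ s m n k : ℕ, b - a + 2 * q + m ≤ (p ^ s : ℕ) → ¬ p ∣ n.choose k →
      ∃ h : pathSubgroup K,
        (∀ i, h.1 i ≠ 0 → (p ^ s : ℕ) * (k : ℤ) + (a - q) ≤ i ∧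
          i < (p ^ s : ℕ) * (k : ℤ) + (a - q) + (p ^ s : ℕ)) ∧
        χ ((linEnd η ρ hη hρ ^ (m + p ^ s * n)) h) ≠ 0 := by
  have hN : Nat.card G • χ = 0 := by
    ext h
    rw [AddMonoidHom.nsmul_apply, ← map_nsmul]
    have : Nat.card G • h = 0 := by
      ext i
      simp
    rw [this, map_zero]; rfl
  obtain ⟨p, m, hp, hm, hpm⟩ := exists_nsmul_prime_order hne Nat.card_pos hN
  refine ⟨p, hp, fun s m' n k h1 h2 => ?_⟩
  obtain ⟨h, hs, hh⟩ := exists_block_of_prime η ρ hη hρ (ψ := m • χ)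
    (fun h hz => by rw [AddMonoidHom.nsmul_apply, hχ h hz, smul_zero]) hab hq hcomm hm hp hpm h1 h2
  refine ⟨h, hs, fun h0 => hh ?_⟩
  rw [AddMonoidHom.nsmul_apply, h0, smul_zero]

end LinearAutomaton

/-! ### Binomial coefficients not divisible by a prime -/

/-- The number of entries of row `n` of Pascal's triangle not divisible by `p`. -/
def unitBinomials (p n : ℕ) : Finset ℕ := (Finset.range (n + 1)).filter fun k => ¬ p ∣ n.choose k

theorem mem_unitBinomials {p n k : ℕ} : k ∈ unitBinomials p n ↔ ¬ p ∣ n.choose k := by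
  simp only [unitBinomials, Finset.mem_filter, Finset.mem_range, and_iff_right_iff_imp]
  intro h
  by_contra hk
  exact h (by rw [Nat.choose_eq_zero_of_lt (by omega)]; exact dvd_zero p)

theorem one_le_card_unitBinomials {p : ℕ} (hp : p.Prime) (n : ℕ) :
    1 ≤ (unitBinomials p n).card := by
  refine Finset.card_pos.mpr ⟨0, mem_unitBinomials.mpr ?_⟩
  simpa using hp.one_lt.ne'

theorem mul_add_mem_unitBinomials {p : ℕ} (hp : p.Prime) {n d k e : ℕ} (hd : d < p) (he : e < p)
    (hde : ¬ p ∣ d.choose e) (hk : k ∈ unitBinomials p n) :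
    p * k + e ∈ unitBinomials p (p * n + d) := by
  have := Fact.mk hp
  rw [mem_unitBinomials] at hk ⊢
  have h := Choose.choose_modEq_choose_mod_mul_choose_div_nat (n := p * n + d) (k := p * k + e)
    (p := p)
  rw [Nat.mul_add_mod, Nat.mul_add_mod, Nat.mod_eq_of_lt hd, Nat.mod_eq_of_lt he,
    Nat.mul_add_div hp.pos, Nat.mul_add_div hp.pos, Nat.div_eq_of_lt hd, Nat.div_eq_of_lt he,
    add_zero, add_zero] at h
  rw [h.dvd_iff dvd_rfl, hp.dvd_mul]
  tauto

theorem card_unitBinomials_le {p : ℕ} (hp : p.Prime) (n : ℕ) {d : ℕ} (hd : d < p) :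
    (unitBinomials p n).card ≤ (unitBinomials p (p * n + d)).card := by
  refine Finset.card_le_card_of_injOn (fun k => p * k) (fun k hk => ?_) fun a _ b _ h =>
    Nat.eq_of_mul_eq_mul_left hp.pos h
  have := mul_add_mem_unitBinomials hp hd hp.pos (by simpa using hp.one_lt.ne') hk
  simpa using this

theorem two_mul_card_unitBinomials_le {p : ℕ} (hp : p.Prime) (n : ℕ) {d : ℕ} (hd : d < p)
    (hd0 : d ≠ 0) :
    2 * (unitBinomials p n).card ≤ (unitBinomials p (p * n + d)).card := by
  have hsub : (unitBinomials p n).image (fun k => p * k) ∪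
      (unitBinomials p n).image (fun k => p * k + 1) ⊆ unitBinomials p (p * n + d) := by
    refine Finset.union_subset ?_ ?_ <;> intro j hj <;> obtain ⟨k, hk, rfl⟩ := Finset.mem_image.mp hj
    · simpa using mul_add_mem_unitBinomials hp hd hp.pos (by simpa using hp.one_lt.ne') hk
    · exact mul_add_mem_unitBinomials hp hd hp.one_lt
        (by rw [Nat.choose_one_right]; exact Nat.not_dvd_of_pos_of_lt (Nat.pos_of_ne_zero hd0) hd) hk
  have hdisj : Disjoint ((unitBinomials p n).image (fun k => p * k))
      ((unitBinomials p n).image (fun k => p * k + 1)) := by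
    rw [Finset.disjoint_left]
    intro j h1 h2
    obtain ⟨k, -, rfl⟩ := Finset.mem_image.mp h1
    obtain ⟨l, -, hl⟩ := Finset.mem_image.mp h2
    have := congrArg (· % p) hl
    simp [Nat.mod_eq_of_lt hp.one_lt] at this
  refine le_trans ?_ (Finset.card_le_card hsub)
  rw [Finset.card_union_of_disjoint hdisj, Finset.card_image_of_injective _ fun a b h =>
      Nat.eq_of_mul_eq_mul_left hp.pos h, Finset.card_image_of_injective _ fun a b h =>
      Nat.eq_of_mul_eq_mul_left hp.pos (Nat.succ_injective h)]
  omega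

theorem sum_range_mul_eq {M : Type*} [AddCommMonoid M] (a : ℕ → M) (p n : ℕ) :
    ∑ i ∈ Finset.range (p * n), a i =
      ∑ m ∈ Finset.range n, ∑ d ∈ Finset.range p, a (p * m + d) := by
  induction n with
  | zero => simp
  | succ n ih => rw [mul_add_one, Finset.sum_range_add, ih, Finset.sum_range_succ]

/-- The number of `n < N` whose row of Pascal's triangle has less than `R` entries prime to `p`. -/
noncomputable def fewUnits (p R N : ℕ) : ℝ :=
  ∑ n ∈ Finset.range N, if (unitBinomials p n).card < R then (1 : ℝ) else 0

theorem fewUnits_le (p R N : ℕ) : fewUnits p R N ≤ N := by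
  refine (Finset.sum_le_sum (g := fun _ => (1 : ℝ)) fun n _ => ?_).trans (by simp)
  split_ifs <;> norm_num

theorem fewUnits_add_le (p R N d : ℕ) : fewUnits p R (N + d) ≤ fewUnits p R N + d := by
  unfold fewUnits
  rw [Finset.sum_range_add]
  refine add_le_add le_rfl
    ((Finset.sum_le_sum (g := fun _ => (1 : ℝ)) fun n _ => ?_).trans (by simp))
  split_ifs <;> norm_num

theorem fewUnits_mul_le {p : ℕ} (hp : p.Prime) (R N : ℕ) :
    fewUnits p (2 * R) (p * N) ≤ fewUnits p (2 * R) N + (p - 1) * fewUnits p R N := by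
  unfold fewUnits
  rw [sum_range_mul_eq, Finset.mul_sum, ← Finset.sum_add_distrib]
  refine Finset.sum_le_sum fun m _ => ?_
  obtain ⟨r, rfl⟩ : ∃ r, p = r + 1 := ⟨p - 1, by have := hp.pos; omega⟩
  rw [Finset.sum_range_succ', add_comm]
  refine add_le_add ?_ ?_
  · have := card_unitBinomials_le hp m (d := 0) (by omega)
    split_ifs <;> first | omega | norm_num
  · have hcast : ((r + 1 : ℕ) : ℝ) - 1 = r := by push_cast; ring
    rw [hcast]
    refine (Finset.sum_le_card_nsmul _ _ (if (unitBinomials (r + 1) m).card < R then (1 : ℝ) else 0)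
      fun d hd => ?_).trans (by simp)
    have := two_mul_card_unitBinomials_le hp m (d := d + 1)
      (by have := Finset.mem_range.mp hd; omega) (by omega)
    split_ifs <;> first | omega | norm_num

/-- Almost all rows of Pascal's triangle have many entries prime to `p`. -/
theorem exists_fewUnits_le {p : ℕ} (hp : p.Prime) (j : ℕ) : ∀ ε : ℝ, 0 < ε →
    ∃ K : ℝ, 0 ≤ K ∧ ∀ N : ℕ, fewUnits p (2 ^ j) N ≤ ε * N + K := by
  induction j with
  | zero =>
    intro ε hε
    refine ⟨0, le_rfl, fun N => ?_⟩
    have : fewUnits p (2 ^ 0) N = 0 := Finset.sum_eq_zero fun n _ => by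
      have := one_le_card_unitBinomials hp n
      rw [if_neg (by rw [pow_zero]; omega)]
    rw [this]
    positivity
  | succ j ih =>
    intro ε hε
    obtain ⟨K, hK, h⟩ := ih (ε / 2) (by positivity)
    obtain ⟨M₀, hM₀⟩ := exists_nat_ge ((p + p * K) / (ε / 2))
    have hp2 : (2 : ℝ) ≤ p := by exact_mod_cast hp.two_le
    refine ⟨p * M₀ + p, by positivity, fun N => ?_⟩
    induction N using Nat.strong_induction_on with
    | _ N ihN =>
      have hN := Nat.div_add_mod N p
      have hd : N % p < p := Nat.mod_lt _ hp.pos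
      have hd' : ((N % p : ℕ) : ℝ) ≤ p := by exact_mod_cast hd.le
      have hNr : (N : ℝ) = p * (N / p : ℕ) + (N % p : ℕ) := by exact_mod_cast hN.symm
      rcases le_or_gt (N / p) M₀ with hlt | hge
      · refine (fewUnits_le _ _ _).trans ?_
        have : ((N / p : ℕ) : ℝ) ≤ M₀ := by exact_mod_cast hlt
        have h3 : (p : ℝ) * (N / p : ℕ) ≤ p * M₀ := by gcongr
        have h4 : 0 ≤ ε * N := by positivity
        linarith
      · have hlt : N / p < N := Nat.div_lt_self
          (Nat.pos_of_ne_zero (by rintro rfl; simp at hge)) hp.one_lt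
        have h1 := fewUnits_add_le p (2 ^ (j + 1)) (p * (N / p)) (N % p)
        rw [hN] at h1
        have h2 := fewUnits_mul_le hp (2 ^ j) (N / p)
        rw [← pow_succ'] at h2
        have h3 := ihN _ hlt
        have h4 := h (N / p)
        have hge' : (M₀ : ℝ) ≤ (N / p : ℕ) := by exact_mod_cast hge.le
        have h5 : (p + p * K) ≤ (N / p : ℕ) * (ε / 2) :=
          (div_le_iff₀ (by positivity)).mp (hM₀.trans hge')
        set X : ℝ := ((N / p : ℕ) : ℝ)
        have h6 : ((p : ℝ) - 1) * fewUnits p (2 ^ j) (N / p) ≤ (p - 1) * (ε / 2 * X + K) := by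
          gcongr
          linarith
        have hX : 0 ≤ X := Nat.cast_nonneg _
        have h7 : ε * N = ε * p * X + ε * (N % p : ℕ) := by rw [hNr]; ring
        have h8 : 0 ≤ ε * (N % p : ℕ) := by positivity
        have h9 : 0 ≤ (p - 2) * (ε * X) := mul_nonneg (by linarith) (by positivity)
        nlinarith

/-! ### Box masses of measures with complete connections -/

section Box

variable {G : Type*}

/-- The sequences agreeing with `x` on `[a, b)`. -/
def box (a b : ℤ) (x : ℤ → G) : Set (ℤ → G) := {y | ∀ i, a ≤ i → i < b → y i = x i}

/-- The word of `x` on `[a, b)` has allowed transitions. -/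
def Admissible (E : Set (G × G)) (a b : ℤ) (x : ℤ → G) : Prop :=
  ∀ i, a ≤ i → i + 1 < b → (x i, x (i + 1)) ∈ E

theorem box_congr {a b : ℤ} {x y : ℤ → G} (h : ∀ i, a ≤ i → i < b → x i = y i) :
    box a b x = box a b y := by
  ext z
  exact ⟨fun hz i h1 h2 => (hz i h1 h2).trans (h i h1 h2),
    fun hz i h1 h2 => (hz i h1 h2).trans (h i h1 h2).symm⟩

theorem box_subset_box {a b a' b' : ℤ} (ha : a' ≤ a) (hb : b ≤ b') (x : ℤ → G) :
    box a' b' x ⊆ box a b x := fun _ hy i h1 h2 => hy i (ha.trans h1) (h2.trans_le hb)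

theorem Admissible.mono {E : Set (G × G)} {a b a' b' : ℤ} {x : ℤ → G}
    (h : Admissible E a' b' x) (ha : a' ≤ a) (hb : b ≤ b') : Admissible E a b x :=
  fun i h1 h2 => h i (ha.trans h1) (h2.trans_le hb)

theorem Admissible.congr {E : Set (G × G)} {a b : ℤ} {x y : ℤ → G} (hx : Admissible E a b x)
    (h : ∀ i, a ≤ i → i < b → x i = y i) : Admissible E a b y := fun i h1 h2 => by
  rw [← h i h1 (by omega), ← h (i + 1) (by omega) h2]
  exact hx i h1 h2

theorem admissible_of_mem_TMC {E : Set (G × G)} {x : ℤ → G} (hx : x ∈ TMC E) (a b : ℤ) :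
    Admissible E a b x := fun i _ _ => hx i

theorem exists_TMC_at {E : Set (G × G)} (hE : EveryLetterOccurs E) (g : G) (a : ℤ) :
    ∃ x ∈ TMC E, x a = g := by
  obtain ⟨x, hx, i, hi⟩ := hE g
  exact ⟨_, TMC_shift hx (i - a), by rw [add_sub_cancel]; exact hi⟩

theorem Admissible.exists_mem_TMC {E : Set (G × G)} (hE : EveryLetterOccurs E) {a b : ℤ}
    {x : ℤ → G} (hx : Admissible E a b x) : ∃ y ∈ TMC E, y ∈ box a b x := by
  obtain ⟨u, hu, hua⟩ := exists_TMC_at hE (x a) a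
  rcases le_or_gt b a with hab | hab
  · exact ⟨u, hu, fun i h1 h2 => by omega⟩
  obtain ⟨v, hv, hvb⟩ := exists_TMC_at hE (x (b - 1)) (b - 1)
  refine ⟨fun i => if i < a then u i else if i < b then x i else v i, fun i => ?_, fun i h1 h2 => ?_⟩
  · dsimp only
    rcases lt_trichotomy (i + 1) a with h | h | h
    · rw [if_pos (by omega), if_pos h]
      exact hu i
    · rw [if_pos (by omega), if_neg (by omega), if_pos (by omega), h, ← hua, ← h]
      exact hu i
    · rw [if_neg (show ¬ i < a by omega), if_neg (show ¬ i + 1 < a by omega)]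
      rcases lt_trichotomy (i + 1) b with h' | h' | h'
      · rw [if_pos (by omega), if_pos h']
        exact hx i (by omega) h'
      · rw [if_pos (by omega), if_neg (by omega)]
        have hi : i = b - 1 := by omega
        have := hv i
        rwa [hi, hvb, ← hi] at this
      · rw [if_neg (by omega), if_neg (by omega)]
        exact hv i
  · dsimp only
    rw [if_neg (by omega), if_pos h2]

end Box

section Mass

variable {G : Type*} [Fintype G] [MeasurableSpace G] [MeasurableSingletonClass G]
  {E : Set (G × G)} {μ : Measure (ℤ → G)}

theorem measurableSet_box (a b : ℤ) (x : ℤ → G) : MeasurableSet (box a b x) := by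
  simp only [box, Set.ofPred_forall]
  exact MeasurableSet.iInter fun i => MeasurableSet.iInter fun _ => MeasurableSet.iInter fun _ =>
    measurableSet_eq_fun (measurable_pi_apply i) measurable_const

theorem measurableSet_TMC (E : Set (G × G)) : MeasurableSet (TMC E) := by
  simp only [TMC, Set.ofPred_forall]
  exact MeasurableSet.iInter fun i =>
    ((measurable_pi_apply i).prodMk (measurable_pi_apply (i + 1))) E.toFinite.measurableSet

/-- The mass of the sequences agreeing with `x` on `[a, b)`. -/
noncomputable def mass (μ : Measure (ℤ → G)) (a b : ℤ) (x : ℤ → G) : ℝ := μ.real (box a b x)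

theorem mass_nonneg (a b : ℤ) (x : ℤ → G) : 0 ≤ mass μ a b x := measureReal_nonneg

theorem mass_congr {a b : ℤ} {x y : ℤ → G} (h : ∀ i, a ≤ i → i < b → x i = y i) :
    mass μ a b x = mass μ a b y := by rw [mass, mass, box_congr h]

theorem mass_le_one [IsProbabilityMeasure μ] (a b : ℤ) (x : ℤ → G) : mass μ a b x ≤ 1 :=
  measureReal_le_one

theorem mass_mono [IsProbabilityMeasure μ] {a b a' b' : ℤ} (ha : a' ≤ a) (hb : b ≤ b')
    (x : ℤ → G) : mass μ a' b' x ≤ mass μ a b x :=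
  measureReal_mono (box_subset_box ha hb x)

theorem measurable_shiftBy (k : ℤ) : Measurable fun (x : ℤ → G) i => x (i + k) :=
  measurable_pi_lambda _ fun i => measurable_pi_apply (i + k)

theorem measurePreserving_shiftBy (hμ : Measure.map shiftMap μ = μ) (k : ℤ) :
    MeasurePreserving (fun (x : ℤ → G) i => x (i + k)) μ μ := by
  have h1 : MeasurePreserving (fun (x : ℤ → G) i => x (i + 1)) μ μ :=
    ⟨measurable_shiftBy 1, hμ⟩
  have h2 : MeasurePreserving (fun (x : ℤ → G) i => x (i + -1)) μ μ := by
    refine ⟨measurable_shiftBy (-1), ?_⟩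
    conv_lhs => rw [← h1.map_eq]
    rw [Measure.map_map (measurable_shiftBy (-1)) (measurable_shiftBy 1)]
    convert Measure.map_id using 2
    ext x i
    simp
  induction k using Int.induction_on with
  | zero =>
    have h0 : (fun (x : ℤ → G) i => x (i + 0)) = id := by
      ext x i
      simp
    rw [h0]
    exact MeasurePreserving.id μ
  | succ k ih =>
    have := h1.comp ih
    convert this using 3
    simp only [Function.comp_apply]
    congr 1; ring
  | pred k ih =>
    have := h2.comp ih
    convert this using 3
    simp only [Function.comp_apply]
    congr 1; ring

theorem mass_shift (hμ : Measure.map shiftMap μ = μ) (a b k : ℤ) (x : ℤ → G) :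
    mass μ a b (fun i => x (i + k)) = mass μ (a + k) (b + k) x := by
  rw [mass, mass, ← (measurePreserving_shiftBy hμ k).measureReal_preimage
    (measurableSet_box _ _ _).nullMeasurableSet]
  congr 1
  ext y
  constructor
  · intro h i h1 h2
    have := h (i - k) (by omega) (by omega)
    simpa using this
  · intro h i h1 h2
    exact h (i + k) (by omega) (by omega)

theorem cyl_eq_box {m : ℕ} {w : Fin m → G} {x : ℤ → G} (h : ∀ i : Fin m, w i = x (i : ℕ)) :
    cyl w = box 0 m x := by
  ext y
  constructor
  · intro hy i h1 h2
    have := hy ⟨i.toNat, by omega⟩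
    rw [h] at this
    simpa [Int.toNat_of_nonneg h1] using this
  · intro hy i
    rw [h]
    exact hy _ (by omega) (by have := i.2; omega)

theorem mass_pos_iff (hE : EveryLetterOccurs E) (hg : GoodMeasure E μ) {a b : ℤ} {x : ℤ → G} :
    0 < mass μ a b x ↔ Admissible E a b x := by
  obtain ⟨hprob, hinv, hT, hpos⟩ := hg
  constructor
  · intro h
    have h1 : μ (box a b x) ≠ 0 := fun h0 => by simp [mass, Measure.real, h0] at h
    have h2 : μ (TMC E)ᶜ = 0 := (prob_compl_eq_zero_iff (measurableSet_TMC E)).mpr hT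
    have h3 : μ (box a b x ∩ TMC E) ≠ 0 := by
      rwa [measure_inter_conull h2]
    obtain ⟨y, hy, hyT⟩ := nonempty_of_measure_ne_zero h3
    exact (admissible_of_mem_TMC hyT a b).congr hy
  · intro h
    obtain ⟨y, hy, hyx⟩ := h.exists_mem_TMC hE
    rw [← mass_congr hyx]
    rcases le_or_gt b a with hab | hab
    · have : box a b y = Set.univ := Set.eq_univ_of_forall fun z i h1 h2 => by omega
      simp [mass, this]
    have e : mass μ 0 (b - a) (fun i => y (i + a)) = mass μ a b y := by
      rw [mass_shift hinv]; congr 1 <;> ring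
    have h4 := hpos (b - a).toNat (fun i => y ((i : ℕ) + a)) ⟨_, TMC_shift hy a, 0, fun i => by simp⟩
    rw [cyl_eq_box (x := fun i => y (i + a)) fun i => rfl, Int.toNat_of_nonneg (by omega)] at h4
    rw [← e]
    exact ENNReal.toReal_pos h4.ne' (measure_ne_top _ _)

theorem mass_eq_sum_update [IsProbabilityMeasure μ] [DecidableEq ℤ] (a b : ℤ) (hab : a ≤ b)
    (x : ℤ → G) :
    mass μ a b x = ∑ z : G, mass μ (a - 1) b (Function.update x (a - 1) z) := by
  have hu : box a b x = ⋃ z ∈ (Finset.univ : Finset G),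
      box (a - 1) b (Function.update x (a - 1) z) := by
    ext y
    simp only [Finset.mem_univ, Set.iUnion_true, Set.mem_iUnion]
    constructor
    · intro hy
      refine ⟨y (a - 1), fun i h1 h2 => ?_⟩
      rcases eq_or_ne i (a - 1) with rfl | hi
      · simp
      · rw [Function.update_of_ne hi]
        exact hy i (by omega) h2
    · rintro ⟨z, hz⟩ i h1 h2
      rw [hz i (by omega) h2, Function.update_of_ne (by omega)]
  rw [mass, hu, measureReal_biUnion_finset]
  · rfl
  · intro z _ z' _ hzz
    refine Set.disjoint_left.mpr fun y h1 h2 => hzz ?_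
    have e1 := h1 (a - 1) le_rfl (by omega)
    have e2 := h2 (a - 1) le_rfl (by omega)
    simpa using e1.symm.trans e2
  · exact fun z _ => measurableSet_box _ _ _

/-- Letterwise extension to the left ad infinitum. -/
theorem exists_left_extension (Q : ℕ → (ℤ → G) → Prop)
    (hQ : ∀ (n : ℕ) y y', (∀ i, -(n : ℤ) ≤ i → y i = y' i) → Q n y → Q n y') (m : ℕ)
    (hstep : ∀ (n : ℕ) y, m ≤ n → Q n y → ∃ z, Q (n + 1) (Function.update y (-(n : ℤ) - 1) z))
    {x : ℤ → G} (hx : Q m x) :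
    ∃ y, (∀ i, -(m : ℤ) ≤ i → y i = x i) ∧ ∀ n, m ≤ n → Q n y := by
  classical
  let st : ℕ → (ℤ → G) → (ℤ → G) := fun n y =>
    if h : m ≤ n ∧ Q n y then Function.update y (-(n : ℤ) - 1) (hstep n y h.1 h.2).choose else y
  let Y : ℕ → (ℤ → G) := fun k => Nat.rec x (fun k y => st (m + k) y) k
  have hYs : ∀ k, Y (k + 1) = st (m + k) (Y k) := fun k => rfl
  have hYQ : ∀ k, Q (m + k) (Y k) := by
    intro k
    induction k with
    | zero => exact hx
    | succ k ih =>
      have h : m ≤ m + k ∧ Q (m + k) (Y k) := ⟨Nat.le_add_right _ _, ih⟩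
      rw [hYs]
      simp only [st, dif_pos h]
      exact (hstep _ _ h.1 h.2).choose_spec
  have hYe : ∀ k d i, -((m + k : ℕ) : ℤ) ≤ i → Y (k + d) i = Y k i := by
    intro k d i hi
    induction d with
    | zero => rfl
    | succ d ih =>
      rw [← add_assoc, hYs]
      simp only [st]
      split_ifs
      · rw [Function.update_of_ne (by push_cast at *; omega), ih]
      · exact ih
  have hYl : ∀ k i, -((m + k : ℕ) : ℤ) ≤ i → Y (-i).toNat i = Y k i := by
    intro k i hi
    rcases le_total k (-i).toNat with h | h
    · obtain ⟨d, hd⟩ := Nat.exists_eq_add_of_le h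
      rw [hd, hYe k d i hi]
    · obtain ⟨d, hd⟩ := Nat.exists_eq_add_of_le h
      conv_rhs => rw [hd]
      rw [hYe _ d i (by push_cast; omega)]
  refine ⟨fun i => Y (-i).toNat i, fun i hi => hYl 0 i (by simpa using hi), fun n hn => ?_⟩
  obtain ⟨k, rfl⟩ := Nat.exists_eq_add_of_le hn
  exact hQ _ _ _ (fun i hi => (hYl k i hi).symm) (hYQ k)

end Mass

section CompleteConnections

variable {G : Type*} [Fintype G] [MeasurableSpace G] [MeasurableSingletonClass G]
  {E : Set (G × G)} {μ : Measure (ℤ → G)}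

/-- Complete connections and summable decay in terms of box masses. -/
theorem CCSD.exists_mass (hg : GoodMeasure E μ) (h : CCSD E μ) :
    ∃ (ν : (ℤ → G) → ℝ) (γ : ℕ → ℝ), Summable γ ∧ (∀ m, 0 ≤ γ m) ∧
      (∀ y, (∀ i < 0, (y i, y (i + 1)) ∈ E) → 0 < ν y ∧
        Tendsto (fun m : ℕ => mass μ (-m) 1 y / mass μ (-m) 0 y) atTop (𝓝 (ν y))) ∧
      ∀ m : ℕ, 1 ≤ m → ∀ y z, (∀ i < 0, (y i, y (i + 1)) ∈ E) →
        (∀ i < 0, (z i, z (i + 1)) ∈ E) → (∀ i, -(m : ℤ) ≤ i → i ≤ 0 → y i = z i) →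
        ν y ≤ (1 + γ m) * ν z := by
  obtain ⟨ν, hν, γ, hγ, hdec⟩ := h
  obtain ⟨_, hinv, -, -⟩ := hg
  have hpast : ∀ y : ℤ → G, (∀ i < 0, (y i, y (i + 1)) ∈ E) →
      IsPast E fun i : ℕ => y (-(i : ℤ) - 1) := fun y hy i => by
    have := hy (-(i : ℤ) - 2) (by omega)
    convert this using 3 <;> push_cast <;> ring
  have hedge : ∀ y : ℤ → G, (∀ i < 0, (y i, y (i + 1)) ∈ E) →
      (y (-((0 : ℕ) : ℤ) - 1), y 0) ∈ E := fun y hy => by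
    simpa using hy (-1) (by omega)
  have hword : ∀ (y : ℤ → G) (m : ℕ) (j : ℕ), j < m →
      y (-((m - 1 - j : ℕ) : ℤ) - 1) = y ((j : ℤ) + (-(m : ℤ))) := fun y m j hj => by
    congr 1
    omega
  refine ⟨fun y => ν (fun i : ℕ => y (-(i : ℤ) - 1)) (y 0), fun m => |γ m|, hγ.abs,
    fun m => abs_nonneg _, fun y hy => ?_, fun m hm y z hy hz hyz => ?_⟩
  · obtain ⟨h1, h2⟩ := hν _ (hpast y hy) _ (hedge y hy)
    refine ⟨h1, h2.congr fun m => ?_⟩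
    have e0 : mass μ (-m) 0 y = μ.real (cyl (pastWord (fun i : ℕ => y (-(i : ℤ) - 1)) m)) := by
      rw [cyl_eq_box (w := pastWord (fun i : ℕ => y (-(i : ℤ) - 1)) m)
        (x := fun i => y (i + (-(m : ℤ)))) fun i => hword y m i i.2, ← mass, mass_shift hinv]
      congr 1 <;> ring
    have e1 : mass μ (-m) 1 y =
        μ.real (cyl (Fin.snoc (pastWord (fun i : ℕ => y (-(i : ℤ) - 1)) m) (y 0) :
          Fin (m + 1) → G)) := by
      rw [cyl_eq_box (x := fun i => y (i + (-(m : ℤ))))]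
      · rw [← mass, mass_shift hinv]
        congr 1 <;> push_cast <;> ring
      · intro i
        refine Fin.lastCases ?_ (fun j => ?_) i
        · simp
        · rw [Fin.snoc_castSucc]
          exact hword y m j j.2
    rw [e0, e1]
    rfl
  · have h0 : y 0 = z 0 := hyz 0 (by omega) le_rfl
    have := hdec m hm _ _ (hpast y hy) (hpast z hz) (fun i hi => hyz _ (by omega) (by omega))
      (y 0) (hedge y hy)
    have hzpos := (hν _ (hpast z hz) (y 0) (h0 ▸ hedge z hz)).1
    dsimp only
    rw [← h0, ← div_le_iff₀ hzpos]
    linarith [le_abs_self (ν (fun i : ℕ => y (-(i : ℤ) - 1)) (y 0) /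
      ν (fun i : ℕ => z (-(i : ℤ) - 1)) (y 0) - 1), le_abs_self (γ m)]

theorem Admissible.exists_update_ge (hE : EveryLetterOccurs E) (hg : GoodMeasure E μ) {n : ℕ}
    {y : ℤ → G} (hy : Admissible E (-n) 1 y) {r : ℝ}
    (hr : r * mass μ (-n) 0 y ≤ mass μ (-n) 1 y) :
    ∃ z, Admissible E (-(n : ℤ) - 1) 1 (Function.update y (-(n : ℤ) - 1) z) ∧
      r * mass μ (-(n : ℤ) - 1) 0 (Function.update y (-(n : ℤ) - 1) z) ≤
        mass μ (-(n : ℤ) - 1) 1 (Function.update y (-(n : ℤ) - 1) z) := by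
  have := hg.1
  rw [mass_eq_sum_update _ 0 (by omega), mass_eq_sum_update _ 1 (by omega), Finset.mul_sum] at hr
  by_contra! hcon
  have hpos : 0 < ∑ z, mass μ (-(n : ℤ) - 1) 1 (Function.update y (-(n : ℤ) - 1) z) := by
    rw [← mass_eq_sum_update _ 1 (by omega)]
    exact (mass_pos_iff hE hg).mpr hy
  obtain ⟨z₀, -, hz₀⟩ := Finset.exists_lt_of_sum_lt (s := Finset.univ)
    (f := fun _ : G => (0 : ℝ)) (by simpa using hpos)
  rcases le_or_gt r 0 with hr0 | hr0
  · have := hcon z₀ ((mass_pos_iff hE hg).mp hz₀)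
    nlinarith [mass_nonneg (μ := μ) (-(n : ℤ) - 1) 0 (Function.update y (-(n : ℤ) - 1) z₀)]
  refine hr.not_gt (Finset.sum_lt_sum (fun z _ => ?_)
    ⟨z₀, Finset.mem_univ _, hcon z₀ ((mass_pos_iff hE hg).mp hz₀)⟩)
  by_cases hz : Admissible E (-(n : ℤ) - 1) 1 (Function.update y (-(n : ℤ) - 1) z)
  · exact (hcon z hz).le
  · refine (not_lt.mp (mt (mass_pos_iff hE hg).mp hz)).trans ?_
    exact mul_nonneg hr0.le (mass_nonneg _ _ _)

theorem Admissible.exists_update_le (hE : EveryLetterOccurs E) (hg : GoodMeasure E μ) {n : ℕ}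
    (hn : 1 ≤ n) {y : ℤ → G} (hy : Admissible E (-n) 1 y) {r : ℝ}
    (hr : mass μ (-n) 1 y ≤ r * mass μ (-n) 0 y) :
    ∃ z, Admissible E (-(n : ℤ) - 1) 1 (Function.update y (-(n : ℤ) - 1) z) ∧
      mass μ (-(n : ℤ) - 1) 1 (Function.update y (-(n : ℤ) - 1) z) ≤
        r * mass μ (-(n : ℤ) - 1) 0 (Function.update y (-(n : ℤ) - 1) z) := by
  have := hg.1
  rw [mass_eq_sum_update _ 0 (by omega), mass_eq_sum_update _ 1 (by omega), Finset.mul_sum] at hr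
  by_contra! hcon
  have hpos : 0 < ∑ z, mass μ (-(n : ℤ) - 1) 1 (Function.update y (-(n : ℤ) - 1) z) := by
    rw [← mass_eq_sum_update _ 1 (by omega)]
    exact (mass_pos_iff hE hg).mpr hy
  obtain ⟨z₀, -, hz₀⟩ := Finset.exists_lt_of_sum_lt (s := Finset.univ)
    (f := fun _ : G => (0 : ℝ)) (by simpa using hpos)
  refine hr.not_gt (Finset.sum_lt_sum (fun z _ => ?_)
    ⟨z₀, Finset.mem_univ _, hcon z₀ ((mass_pos_iff hE hg).mp hz₀)⟩)
  by_cases hz : Admissible E (-(n : ℤ) - 1) 1 (Function.update y (-(n : ℤ) - 1) z)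
  · exact (hcon z hz).le
  · have h0 : ¬ Admissible E (-(n : ℤ) - 1) 0 (Function.update y (-(n : ℤ) - 1) z) := by
      refine fun h0 => hz fun i h1 h2 => ?_
      rcases lt_or_ge (i + 1) 0 with h | h
      · exact h0 i h1 h
      · rw [Function.update_of_ne (by omega), Function.update_of_ne (by omega)]
        exact hy i (by omega) h2
    rw [le_antisymm (not_lt.mp (mt (mass_pos_iff hE hg).mp h0)) (mass_nonneg _ _ _), mul_zero]
    exact mass_nonneg _ _ _

/-- Conditional probabilities of a letter given long pasts that agree nearby are close. -/
theorem CCSD.exists_mass_mul_le (hE : EveryLetterOccurs E) (hg : GoodMeasure E μ)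
    (h : CCSD E μ) :
    ∃ γ : ℕ → ℝ, Summable γ ∧ (∀ m, 0 ≤ γ m) ∧ ∀ m : ℕ, 1 ≤ m → ∀ l l' : ℕ, m ≤ l → m ≤ l' →
      ∀ x y, Admissible E (-l) 1 x → Admissible E (-l') 1 y →
        (∀ i, -(m : ℤ) ≤ i → i ≤ 0 → x i = y i) →
        mass μ (-l) 1 x * mass μ (-l') 0 y ≤
          (1 + γ m) * (mass μ (-l') 1 y * mass μ (-l) 0 x) := by
  obtain ⟨ν, γ, hγ, hγ0, hν, hdec⟩ := h.exists_mass hg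
  refine ⟨γ, hγ, hγ0, fun m hm l l' hl hl' x y hx hy hxy => ?_⟩
  have hx0 : 0 < mass μ (-l) 0 x := (mass_pos_iff hE hg).mpr (hx.mono le_rfl (by omega))
  have hy0 : 0 < mass μ (-l') 0 y := (mass_pos_iff hE hg).mpr (hy.mono le_rfl (by omega))
  set r := mass μ (-l) 1 x / mass μ (-l) 0 x
  set r' := mass μ (-l') 1 y / mass μ (-l') 0 y
  obtain ⟨u, hux, hu⟩ := exists_left_extension
    (fun n w => Admissible E (-n) 1 w ∧ r * mass μ (-n) 0 w ≤ mass μ (-n) 1 w)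
    (fun n w w' hw ⟨h1, h2⟩ => ⟨h1.congr fun i hi _ => hw i hi, by
      rwa [← mass_congr fun i hi _ => hw i hi, ← mass_congr fun i hi _ => hw i hi]⟩) l
    (fun n w hn ⟨h1, h2⟩ => by
      push_cast
      rw [neg_add, ← sub_eq_add_neg]
      exact h1.exists_update_ge hE hg h2) (x := x) ⟨hx, (div_mul_cancel₀ _ hx0.ne').le⟩
  obtain ⟨v, hvy, hv⟩ := exists_left_extension
    (fun n w => 1 ≤ n ∧ Admissible E (-n) 1 w ∧ mass μ (-n) 1 w ≤ r' * mass μ (-n) 0 w)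
    (fun n w w' hw ⟨h0, h1, h2⟩ => ⟨h0, h1.congr fun i hi _ => hw i hi, by
      rwa [← mass_congr fun i hi _ => hw i hi, ← mass_congr fun i hi _ => hw i hi]⟩) l'
    (fun n w hn ⟨h0, h1, h2⟩ => by
      push_cast
      rw [neg_add, ← sub_eq_add_neg]
      obtain ⟨z, hz⟩ := h1.exists_update_le hE hg h0 h2
      exact ⟨z, trivial, hz⟩) (x := y)
    ⟨hm.trans hl', hy, (div_mul_cancel₀ _ hy0.ne').ge⟩
  have hul : ∀ i < 0, (u i, u (i + 1)) ∈ E := fun i hi =>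
    (hu (max l (-i).toNat) (le_max_left _ _)).1 i (by push_cast; omega) (by omega)
  have hvl : ∀ i < 0, (v i, v (i + 1)) ∈ E := fun i hi =>
    (hv (max l' (-i).toNat) (le_max_left _ _)).2.1 i (by push_cast; omega) (by omega)
  have hru : r ≤ ν u := ge_of_tendsto (hν u hul).2 <| (eventually_ge_atTop l).mono fun n hn =>
    (le_div_iff₀ ((mass_pos_iff hE hg).mpr ((hu n hn).1.mono le_rfl (by omega)))).mpr (hu n hn).2
  have hrv : ν v ≤ r' := le_of_tendsto (hν v hvl).2 <| (eventually_ge_atTop l').mono fun n hn =>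
    (div_le_iff₀ ((mass_pos_iff hE hg).mpr ((hv n hn).2.1.mono le_rfl (by omega)))).mpr
      (hv n hn).2.2
  have huv := hdec m hm u v hul hvl fun i h1 h2 => by
    rw [hux i (by omega), hvy i (by omega), hxy i h1 h2]
  have hfin : r ≤ (1 + γ m) * r' :=
    hru.trans (huv.trans (mul_le_mul_of_nonneg_left hrv (by linarith [hγ0 m])))
  rw [div_le_iff₀ hx0] at hfin
  calc mass μ (-l) 1 x * mass μ (-l') 0 y
      ≤ ((1 + γ m) * r' * mass μ (-l) 0 x) * mass μ (-l') 0 y := by gcongr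
    _ = (1 + γ m) * ((r' * mass μ (-l') 0 y) * mass μ (-l) 0 x) := by ring
    _ = _ := by rw [div_mul_cancel₀ _ hy0.ne']

theorem exists_pos_le_mass (hE : EveryLetterOccurs E) (hg : GoodMeasure E μ) [Nonempty G] :
    ∃ c : ℝ, 0 < c ∧ ∀ x ∈ TMC E, c ≤ mass μ (-1) 1 x := by
  let f : G × G → ℝ := fun p => mass μ (-1) 1 fun i => if i < 0 then p.1 else p.2
  obtain ⟨p, hp⟩ := Finite.exists_min fun p : G × G => if 0 < f p then f p else 1
  have hf : ∀ x : ℤ → G, mass μ (-1) 1 x = f (x (-1), x 0) := fun x =>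
    mass_congr fun i h1 h2 => by
      rcases (show i = -1 ∨ i = 0 by omega) with rfl | rfl <;> simp
  refine ⟨if 0 < f p then f p else 1, by split_ifs <;> first | assumption | norm_num,
    fun x hx => ?_⟩
  have h0 : 0 < mass μ (-1) 1 x := (mass_pos_iff hE hg).mpr (admissible_of_mem_TMC hx _ _)
  have := hp (x (-1), x 0)
  rw [hf] at h0 ⊢
  simpa only [h0, if_true] using this

/-- Each letter has conditional probability bounded below. -/
theorem CCSD.exists_mul_mass_le (hE : EveryLetterOccurs E) (hg : GoodMeasure E μ)
    (h : CCSD E μ) [Nonempty G] :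
    ∃ c : ℝ, 0 < c ∧ c ≤ 1 ∧ ∀ x ∈ TMC E, ∀ b d : ℕ, 1 ≤ b →
      c ^ d * mass μ 0 b x ≤ mass μ 0 (b + d : ℕ) x := by
  obtain ⟨γ, -, hγ0, hγ⟩ := h.exists_mass_mul_le hE hg
  obtain ⟨c, hc, hcm⟩ := exists_pos_le_mass hE hg
  obtain ⟨_, hinv, -, -⟩ := id hg
  have hγ1 := hγ0 1
  have hstep : ∀ x ∈ TMC E, ∀ b : ℕ, 1 ≤ b →
      c / (1 + γ 1) * mass μ 0 b x ≤ mass μ 0 (b + 1 : ℕ) x := by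
    intro x hx b hb
    have hx' := TMC_shift hx b
    have h1 := hγ 1 le_rfl 1 b le_rfl hb _ _ (admissible_of_mem_TMC hx' _ _)
      (admissible_of_mem_TMC hx' _ _) fun _ _ _ => rfl
    have e1 : mass μ (-b) 0 (fun i => x (i + b)) = mass μ 0 b x := by
      rw [mass_shift hinv]; congr 1 <;> ring
    have e2 : mass μ (-b) 1 (fun i => x (i + b)) = mass μ 0 (b + 1 : ℕ) x := by
      rw [mass_shift hinv]; congr 1 <;> push_cast <;> ring
    rw [e1, e2] at h1
    have h2 := hcm _ hx'
    have h3 := mass_le_one (μ := μ) (-(1 : ℕ)) 0 (fun i => x (i + b))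
    have h4 := mass_nonneg (μ := μ) 0 b x
    have h5 := mass_nonneg (μ := μ) 0 (b + 1 : ℕ) x
    rw [div_mul_eq_mul_div, div_le_iff₀ (by linarith)]
    calc c * mass μ 0 b x ≤ mass μ (-1) 1 (fun i => x (i + b)) * mass μ 0 b x := by gcongr
      _ ≤ _ := h1
      _ ≤ (1 + γ 1) * (mass μ 0 (b + 1 : ℕ) x * 1) := by gcongr
      _ = _ := by ring
  refine ⟨min (c / (1 + γ 1)) 1, by positivity, min_le_right _ _, fun x hx b d hb => ?_⟩
  induction d with
  | zero => simp
  | succ d ih =>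
    have h1 := hstep x hx (b + d) (by omega)
    have h4 := mass_nonneg (μ := μ) 0 (b + d : ℕ) x
    calc _ = min (c / (1 + γ 1)) 1 * (min (c / (1 + γ 1)) 1 ^ d * mass μ 0 b x) := by ring
      _ ≤ min (c / (1 + γ 1)) 1 * mass μ 0 (b + d : ℕ) x := by gcongr
      _ ≤ c / (1 + γ 1) * mass μ 0 (b + d : ℕ) x := by gcongr; exact min_le_left _ _
      _ ≤ _ := h1

/-- Conditional probabilities of words given long pasts that agree nearby are close. -/
theorem CCSD.exists_ratio (hE : EveryLetterOccurs E) (hg : GoodMeasure E μ) (h : CCSD E μ) :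
    ∃ e : ℕ → ℝ, Tendsto e atTop (𝓝 1) ∧ (∀ m, 1 ≤ e m) ∧
      ∀ m b d : ℕ, 1 ≤ m → m ≤ b → ∀ x ∈ TMC E, ∀ y ∈ TMC E,
        (∀ i, (b : ℤ) - m ≤ i → i < (b + d : ℕ) → x i = y i) →
        mass μ 0 (b + d : ℕ) x * mass μ 0 b y ≤
          e m * (mass μ 0 (b + d : ℕ) y * mass μ 0 b x) := by
  obtain ⟨γ, hγs, hγ0, hγ⟩ := h.exists_mass_mul_le hE hg
  obtain ⟨_, hinv, -, -⟩ := id hg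
  have hstep : ∀ m b : ℕ, 1 ≤ m → m ≤ b → ∀ x ∈ TMC E, ∀ y ∈ TMC E,
      (∀ i, (b : ℤ) - m ≤ i → i ≤ b → x i = y i) →
      mass μ 0 (b + 1 : ℕ) x * mass μ 0 b y ≤
        Real.exp (γ m) * (mass μ 0 (b + 1 : ℕ) y * mass μ 0 b x) := by
    intro m b hm hb x hx y hy hxy
    have e1 : ∀ x, mass μ (-b) 0 (fun i => x (i + b)) = mass μ 0 b x := fun x => by
      rw [mass_shift hinv]; congr 1 <;> ring
    have e2 : ∀ x, mass μ (-b) 1 (fun i => x (i + b)) = mass μ 0 (b + 1 : ℕ) x := fun x => by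
      rw [mass_shift hinv]; congr 1 <;> push_cast <;> ring
    have h1 := hγ m hm b b hb hb _ _ (admissible_of_mem_TMC (TMC_shift hx b) _ _)
      (admissible_of_mem_TMC (TMC_shift hy b) _ _) fun i h1 h2 => hxy _ (by omega) (by omega)
    rw [e1, e2, e1, e2] at h1
    refine h1.trans (mul_le_mul_of_nonneg_right ?_
      (mul_nonneg (mass_nonneg _ _ _) (mass_nonneg _ _ _)))
    linarith [Real.add_one_le_exp (γ m)]
  refine ⟨fun m => Real.exp (∑' j, γ (j + m)), ?_, fun m => ?_, ?_⟩
  · have := Real.continuous_exp.continuousAt.tendsto.comp (tendsto_sum_nat_add γ)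
    rwa [Real.exp_zero] at this
  · exact Real.one_le_exp (tsum_nonneg fun j => hγ0 _)
  · intro m b d hm hb x hx y hy hxy
    have key : mass μ 0 (b + d : ℕ) x * mass μ 0 b y ≤
        Real.exp (∑ j ∈ Finset.range d, γ (j + m)) *
          (mass μ 0 (b + d : ℕ) y * mass μ 0 b x) := by
      induction d with
      | zero => simp [mul_comm]
      | succ d ih =>
        have ih := ih fun i h1 h2 => hxy i h1 (by push_cast at *; omega)
        have hs := hstep (d + m) (b + d) (by omega) (by omega) x hx y hy fun i h1 h2 =>
          hxy i (by push_cast at *; omega) (by push_cast at *; omega)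
        have hpx : 0 < mass μ 0 (b + d : ℕ) x :=
          (mass_pos_iff hE hg).mpr (admissible_of_mem_TMC hx _ _)
        have hpy : 0 < mass μ 0 (b + d : ℕ) y :=
          (mass_pos_iff hE hg).mpr (admissible_of_mem_TMC hy _ _)
        have n1 := mass_nonneg (μ := μ) 0 (b + d + 1 : ℕ) x
        have n2 := mass_nonneg (μ := μ) 0 (b + d + 1 : ℕ) y
        have n3 := mass_nonneg (μ := μ) 0 b x
        have n4 := mass_nonneg (μ := μ) 0 b y
        rw [Finset.sum_range_succ, Real.exp_add, ← add_assoc]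
        refine le_of_mul_le_mul_right ?_ (mul_pos hpx hpy)
        calc _ = (mass μ 0 (b + d + 1 : ℕ) x * mass μ 0 (b + d : ℕ) y) *
              (mass μ 0 (b + d : ℕ) x * mass μ 0 b y) := by ring
          _ ≤ (Real.exp (γ (d + m)) * (mass μ 0 (b + d + 1 : ℕ) y * mass μ 0 (b + d : ℕ) x)) *
              (Real.exp (∑ j ∈ Finset.range d, γ (j + m)) *
                (mass μ 0 (b + d : ℕ) y * mass μ 0 b x)) := by
            gcongr
          _ = _ := by ring
    refine key.trans (mul_le_mul_of_nonneg_right (Real.exp_le_exp.mpr ?_)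
      (mul_nonneg (mass_nonneg _ _ _) (mass_nonneg _ _ _)))
    exact ((summable_nat_add_iff m).mpr hγs).sum_le_tsum _ fun j _ => hγ0 _

end CompleteConnections

/-! ### Conditional averages on finite weighted sets -/

section ClassAverage

open scoped Classical in
/-- The weight of the class of `w`. -/
noncomputable def clsMass {Ω : Type*} [Fintype Ω] (p : Ω → ℝ) (r : Setoid Ω) (w : Ω) : ℝ :=
  ∑ v with r v w, p v

open scoped Classical in
/-- The weighted average of `f` over the class of `w`. -/
noncomputable def clsAvg {Ω : Type*} [Fintype Ω] (p : Ω → ℝ) (r : Setoid Ω) (f : Ω → ℂ)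
    (w : Ω) : ℂ :=
  (∑ v with r v w, (p v : ℂ) * f v) / clsMass p r w

variable {Ω : Type*} [Fintype Ω] {p : Ω → ℝ} {r r' : Setoid Ω} {f g : Ω → ℂ}

theorem clsMass_congr {w w' : Ω} (h : r w w') : clsMass p r w = clsMass p r w' := by
  unfold clsMass
  congr 1
  ext v
  simp only [Finset.mem_filter, Finset.mem_univ, true_and]
  exact ⟨fun hv => r.trans' hv h, fun hv => r.trans' hv (r.symm' h)⟩

theorem clsAvg_congr {w w' : Ω} (h : r w w') : clsAvg p r f w = clsAvg p r f w' := by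
  unfold clsAvg
  rw [clsMass_congr h]
  congr 2
  ext v
  simp only [Finset.mem_filter, Finset.mem_univ, true_and]
  exact ⟨fun hv => r.trans' hv h, fun hv => r.trans' hv (r.symm' h)⟩

theorem le_clsMass (hp : ∀ w, 0 ≤ p w) (w : Ω) : p w ≤ clsMass p r w := by
  classical
  exact Finset.single_le_sum (f := p) (fun v _ => hp v)
    (Finset.mem_filter.mpr ⟨Finset.mem_univ _, r.refl' w⟩)

theorem clsMass_nonneg (hp : ∀ w, 0 ≤ p w) (w : Ω) : 0 ≤ clsMass p r w :=
  (hp w).trans (le_clsMass hp w)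

theorem norm_clsAvg_le (hp : ∀ w, 0 ≤ p w) (hf : ∀ w, ‖f w‖ ≤ 1) (w : Ω) :
    ‖clsAvg p r f w‖ ≤ 1 := by
  classical
  unfold clsAvg
  rw [norm_div, Complex.norm_real, Real.norm_of_nonneg (clsMass_nonneg hp w)]
  refine div_le_one_of_le₀ ((norm_sum_le _ _).trans (Finset.sum_le_sum fun v _ => ?_))
    (clsMass_nonneg hp w)
  rw [norm_mul, Complex.norm_real, Real.norm_of_nonneg (hp v)]
  exact mul_le_of_le_one_right (hp v) (hf v)

theorem sum_clsAvg_mul (hp : ∀ w, 0 ≤ p w) (hg : ∀ v w, r v w → g v = g w) :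
    ∑ w, (p w : ℂ) * (clsAvg p r f w * g w) = ∑ w, (p w : ℂ) * (f w * g w) := by
  classical
  have h1 : ∀ w, (p w : ℂ) * (clsAvg p r f w * g w) =
      ∑ v, if r v w then (p w : ℂ) * ((p v : ℂ) * f v) * (g v / clsMass p r v) else 0 := by
    intro w
    rw [clsAvg, Finset.sum_filter, Finset.sum_div, Finset.sum_mul, Finset.mul_sum]
    refine Finset.sum_congr rfl fun v _ => ?_
    split_ifs with h
    · rw [hg v w h, clsMass_congr h]; ring
    · simp
  rw [Finset.sum_congr rfl fun w _ => h1 w, Finset.sum_comm]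
  refine Finset.sum_congr rfl fun v _ => ?_
  have h2 : ∑ w, (if r v w then (p w : ℂ) * ((p v : ℂ) * f v) * (g v / clsMass p r v) else 0) =
      (clsMass p r v : ℂ) * ((p v : ℂ) * f v) * (g v / clsMass p r v) := by
    rw [clsMass, Complex.ofReal_sum, Finset.sum_filter, Finset.sum_mul, Finset.sum_mul]
    refine Finset.sum_congr rfl fun w _ => ?_
    by_cases h : r v w
    · rw [if_pos h, if_pos (r.symm' h)]
    · rw [if_neg h, if_neg fun h' => h (r.symm' h')]; simp
  rw [h2]
  rcases eq_or_ne (clsMass p r v) 0 with h0 | h0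
  · have : p v = 0 := le_antisymm (h0 ▸ le_clsMass hp v) (hp v)
    simp [this]
  · have : (clsMass p r v : ℂ) ≠ 0 := Complex.ofReal_ne_zero.mpr h0
    field_simp

/-- The weighted square norm of the class averages. -/
noncomputable def clsEnergy (p : Ω → ℝ) (r : Setoid Ω) (f : Ω → ℂ) : ℝ :=
  ∑ w, p w * ‖clsAvg p r f w‖ ^ 2

theorem clsEnergy_nonneg (hp : ∀ w, 0 ≤ p w) : 0 ≤ clsEnergy p r f :=
  Finset.sum_nonneg fun w _ => mul_nonneg (hp w) (sq_nonneg _)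

theorem clsEnergy_le_one (hp : ∀ w, 0 ≤ p w) (hp1 : ∑ w, p w = 1) (hf : ∀ w, ‖f w‖ ≤ 1) :
    clsEnergy p r f ≤ 1 := by
  rw [← hp1]
  refine Finset.sum_le_sum fun w _ => mul_le_of_le_one_right (hp w) ?_
  exact pow_le_one₀ (norm_nonneg _) (norm_clsAvg_le hp hf w)

theorem sum_norm_clsAvg_sub_sq (hp : ∀ w, 0 ≤ p w) (hrr : ∀ v w, r' v w → r v w) :
    ∑ w, p w * ‖clsAvg p r' f w - clsAvg p r f w‖ ^ 2 =
      clsEnergy p r' f - clsEnergy p r f := by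
  have h1 : ∑ w, (p w : ℂ) * (clsAvg p r' f w * (starRingEnd ℂ) (clsAvg p r f w)) =
      ∑ w, (p w : ℂ) * (clsAvg p r f w * (starRingEnd ℂ) (clsAvg p r f w)) := by
    rw [sum_clsAvg_mul hp fun v w h => by rw [clsAvg_congr (hrr v w h)],
      sum_clsAvg_mul hp fun v w h => by rw [clsAvg_congr h]]
  have h2 : ∑ w, p w * (clsAvg p r' f w * (starRingEnd ℂ) (clsAvg p r f w)).re =
      ∑ w, p w * ‖clsAvg p r f w‖ ^ 2 := by
    have := congrArg Complex.re h1
    rw [Complex.re_sum, Complex.re_sum] at this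
    simp only [Complex.re_ofReal_mul] at this
    rw [this]
    refine Finset.sum_congr rfl fun w _ => ?_
    rw [Complex.mul_conj, Complex.ofReal_re, Complex.normSq_eq_norm_sq]
  have h3 : ∀ w, p w * ‖clsAvg p r' f w - clsAvg p r f w‖ ^ 2 =
      p w * ‖clsAvg p r' f w‖ ^ 2 + p w * ‖clsAvg p r f w‖ ^ 2 -
        2 * (p w * (clsAvg p r' f w * (starRingEnd ℂ) (clsAvg p r f w)).re) := by
    intro w
    rw [← Complex.normSq_eq_norm_sq, Complex.normSq_sub, Complex.normSq_eq_norm_sq,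
      Complex.normSq_eq_norm_sq]
    ring
  rw [Finset.sum_congr rfl fun w _ => h3 w, Finset.sum_sub_distrib, Finset.sum_add_distrib,
    ← Finset.mul_sum, h2, clsEnergy, clsEnergy]
  ring

theorem clsEnergy_mono (hp : ∀ w, 0 ≤ p w) (hrr : ∀ v w, r' v w → r v w) :
    clsEnergy p r f ≤ clsEnergy p r' f := by
  rw [← sub_nonneg, ← sum_norm_clsAvg_sub_sq hp hrr]
  exact Finset.sum_nonneg fun w _ => mul_nonneg (hp w) (sq_nonneg _)

theorem norm_clsAvg_comp_sub_le (hp : ∀ w, 0 ≤ p w) (hf : ∀ w, ‖f w‖ ≤ 1) {τ : Ω ≃ Ω} {ζ : ℂ}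
    (hζ : ‖ζ‖ ≤ 1) (hτ : ∀ w, f (τ w) = ζ * f w) (hr : ∀ v w, r (τ v) (τ w) ↔ r v w) {e : ℝ}
    (he : 1 ≤ e) {w : Ω} (hw : 0 < clsMass p r w) (hτw : 0 < clsMass p r (τ w))
    (h1 : ∀ v, r v w → p (τ v) * clsMass p r w ≤ e * (clsMass p r (τ w) * p v))
    (h2 : ∀ v, r v w → p v * clsMass p r (τ w) ≤ e * (clsMass p r w * p (τ v))) :
    ‖clsAvg p r f (τ w) - ζ * clsAvg p r f w‖ ≤ e - 1 := by
  classical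
  have e1 : clsAvg p r f (τ w) =
      ∑ v with r v w, (ζ * f v) * ((p (τ v) / clsMass p r (τ w) : ℝ) : ℂ) := by
    rw [clsAvg, Finset.sum_filter, Finset.sum_filter, ← Equiv.sum_comp τ, Finset.sum_div]
    refine Finset.sum_congr rfl fun v _ => ?_
    simp only [hr]
    split_ifs
    · rw [hτ]; push_cast; ring
    · simp
  have e2 : ζ * clsAvg p r f w =
      ∑ v with r v w, (ζ * f v) * ((p v / clsMass p r w : ℝ) : ℂ) := by
    rw [clsAvg, Finset.sum_div, Finset.mul_sum]
    refine Finset.sum_congr rfl fun v _ => ?_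
    push_cast; ring
  rw [e1, e2, ← Finset.sum_sub_distrib]
  have hsum : ∑ v with r v w, (e - 1) * (p v / clsMass p r w) = e - 1 := by
    rw [← Finset.mul_sum, ← Finset.sum_div, ← clsMass, div_self hw.ne', mul_one]
  refine (norm_sum_le _ _).trans ((Finset.sum_le_sum fun v hv => ?_).trans hsum.le)
  have hv := (Finset.mem_filter.mp hv).2
  rw [← mul_sub, ← Complex.ofReal_sub, norm_mul, Complex.norm_real, norm_mul]
  have h3 : ‖ζ‖ * ‖f v‖ ≤ 1 := mul_le_one₀ hζ (norm_nonneg _) (hf v)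
  refine (mul_le_of_le_one_left (norm_nonneg _) h3).trans ?_
  have q1 : p (τ v) / clsMass p r (τ w) ≤ e * (p v / clsMass p r w) := by
    rw [div_le_iff₀ hτw, mul_div_assoc', div_mul_eq_mul_div, le_div_iff₀ hw]
    linarith [h1 v hv]
  have q2 : p v / clsMass p r w ≤ e * (p (τ v) / clsMass p r (τ w)) := by
    rw [div_le_iff₀ hw, mul_div_assoc', div_mul_eq_mul_div, le_div_iff₀ hτw]
    linarith [h2 v hv]
  have q0 : 0 ≤ p v / clsMass p r w := div_nonneg (hp v) hw.le
  set u := p v / clsMass p r w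
  set u' := p (τ v) / clsMass p r (τ w)
  rw [Real.norm_eq_abs, abs_le]
  constructor
  · rcases le_or_gt u u' with h | h
    · nlinarith
    · nlinarith [mul_nonneg (sub_nonneg.mpr he) (sub_nonneg.mpr h.le)]
  · linarith

theorem norm_sub_one_mul_norm_sum_le (hp : ∀ w, 0 ≤ p w) (hp1 : ∑ w, p w = 1)
    (hrr : ∀ v w, r' v w → r v w) {τ : Ω ≃ Ω} (hτ : ∀ w, r (τ w) w) {ζ : ℂ} {C δ : ℝ}
    (hC : 0 ≤ C) (hpC : ∀ w, p w ≤ C * p (τ w))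
    (hδ : ∀ w, 0 < p w → ‖clsAvg p r' f (τ w) - ζ * clsAvg p r' f w‖ ≤ δ) :
    ‖ζ - 1‖ * ‖∑ w, (p w : ℂ) * f w‖ ≤
      δ + (C + 1) * √(clsEnergy p r' f - clsEnergy p r f) := by
  set M := clsAvg p r f
  set M' := clsAvg p r' f
  have h1 : ∑ w, (p w : ℂ) * f w = ∑ w, (p w : ℂ) * M' w := by
    have := sum_clsAvg_mul (p := p) (r := r') (f := f) (g := fun _ => 1) hp fun _ _ _ => rfl
    simpa using this.symm
  have h2 : ∑ w, p w * ‖M' w - M w‖ ≤ √(clsEnergy p r' f - clsEnergy p r f) := by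
    refine Real.le_sqrt_of_sq_le ?_
    rw [← sum_norm_clsAvg_sub_sq hp hrr]
    have := Finset.sum_mul_sq_le_sq_mul_sq Finset.univ (fun w => √(p w))
      (fun w => √(p w) * ‖M' w - M w‖)
    simp only [← mul_assoc, mul_pow, Real.mul_self_sqrt (hp _), Real.sq_sqrt (hp _), hp1,
      one_mul] at this
    exact this
  have h3 : ∑ w, p w * ‖M' (τ w) - M w‖ ≤ C * √(clsEnergy p r' f - clsEnergy p r f) := by
    refine le_trans ?_ (mul_le_mul_of_nonneg_left h2 hC)
    rw [Finset.mul_sum, ← Equiv.sum_comp τ fun w => C * (p w * ‖M' w - M w‖)]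
    refine Finset.sum_le_sum fun w _ => ?_
    have hM : M w = M (τ w) := clsAvg_congr (r.symm' (hτ w))
    rw [hM, ← mul_assoc]
    exact mul_le_mul_of_nonneg_right (hpC w) (norm_nonneg (M' (τ w) - M (τ w)))
  have h4 : ∀ w, p w * (‖ζ - 1‖ * ‖M' w‖) ≤
      p w * δ + (p w * ‖M' (τ w) - M w‖ + p w * ‖M' w - M w‖) := by
    intro w
    rcases (hp w).eq_or_lt with h0 | h0
    · simp [← h0]
    rw [← mul_add, ← mul_add, ← norm_mul]
    refine mul_le_mul_of_nonneg_left ?_ h0.le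
    have : (ζ - 1) * M' w = -(M' (τ w) - ζ * M' w) + ((M' (τ w) - M w) - (M' w - M w)) := by ring
    rw [this]
    refine (norm_add_le _ _).trans (add_le_add ?_ (norm_sub_le (M' (τ w) - M w) (M' w - M w)))
    rw [norm_neg]
    exact hδ w h0
  calc ‖ζ - 1‖ * ‖∑ w, (p w : ℂ) * f w‖ ≤ ‖ζ - 1‖ * ∑ w, p w * ‖M' w‖ := by
        rw [h1]
        refine mul_le_mul_of_nonneg_left ((norm_sum_le _ _).trans_eq ?_) (norm_nonneg _)
        refine Finset.sum_congr rfl fun w _ => ?_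
        rw [norm_mul, Complex.norm_real, Real.norm_of_nonneg (hp w)]
    _ = ∑ w, p w * (‖ζ - 1‖ * ‖M' w‖) := by
        rw [Finset.mul_sum]
        exact Finset.sum_congr rfl fun w _ => by ring
    _ ≤ ∑ w, (p w * δ + (p w * ‖M' (τ w) - M w‖ + p w * ‖M' w - M w‖)) :=
        Finset.sum_le_sum fun w _ => h4 w
    _ = δ + (∑ w, p w * ‖M' (τ w) - M w‖ + ∑ w, p w * ‖M' w - M w‖) := by
        rw [Finset.sum_add_distrib, Finset.sum_add_distrib, ← Finset.sum_mul, hp1, one_mul]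
    _ ≤ _ := by linarith

theorem exists_increment_le {e : ℕ → ℝ} (he : Monotone e) (h0 : ∀ n, 0 ≤ e n)
    (h1 : ∀ n, e n ≤ 1) (d : ℕ) {S : Finset ℕ} (hS : S.Nonempty) :
    ∃ k ∈ S, e (k + d) - e k ≤ d / S.card := by
  obtain ⟨N, hN⟩ := S.exists_nat_subset_range
  have hsum : ∀ d : ℕ, ∑ k ∈ Finset.range N, (e (k + d) - e k) ≤ d := by
    intro d
    induction d with
    | zero => simp
    | succ d ih =>
      have h2 : ∑ k ∈ Finset.range N, (e (k + 1 + d) - e (k + d)) = e (N + d) - e (0 + d) :=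
        Finset.sum_range_sub (fun k => e (k + d)) N
      have h3 : ∀ k, e (k + (d + 1)) - e k = (e (k + 1 + d) - e (k + d)) + (e (k + d) - e k) :=
        fun k => by rw [show k + (d + 1) = k + 1 + d by ring]; ring
      rw [Finset.sum_congr rfl fun k _ => h3 k, Finset.sum_add_distrib, h2]
      push_cast
      linarith [h0 (0 + d), h1 (N + d)]
  have hcard : (0 : ℝ) < S.card := by exact_mod_cast hS.card_pos
  refine Finset.exists_le_of_sum_le hS ?_
  rw [Finset.sum_const, nsmul_eq_mul, mul_div_cancel₀ _ hcard.ne']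
  exact (Finset.sum_le_sum_of_subset_of_nonneg hN fun k _ _ =>
    sub_nonneg.mpr (he (Nat.le_add_right _ _))).trans (hsum d)

end ClassAverage

/-! ### Decay of character integrals -/

section Words

variable {G : Type*} [AddCommGroup G]

/-- The extension of a word on `[0, T)` by zero. -/
def wordExt {T : ℕ} (w : Fin T → G) : ℤ → G := fun i =>
  if h : 0 ≤ i ∧ i < T then w ⟨i.toNat, by omega⟩ else 0

/-- The word of `x` on `[0, T)`. -/
def wordRestr (T : ℕ) (x : ℤ → G) : Fin T → G := fun j => x (j : ℕ)

/-- Words agreeing on the first `t` letters. -/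
def wordRel (G : Type*) (T t : ℕ) : Setoid (Fin T → G) where
  r v w := ∀ i : Fin T, (i : ℕ) < t → v i = w i
  iseqv := ⟨fun _ _ _ => rfl, fun h i hi => (h i hi).symm,
    fun h h' i hi => (h i hi).trans (h' i hi)⟩

theorem wordExt_of_mem {T : ℕ} (w : Fin T → G) {i : ℤ} (h0 : 0 ≤ i) (h1 : i < T) :
    wordExt w i = w ⟨i.toNat, by omega⟩ := dif_pos ⟨h0, h1⟩

theorem wordExt_coe {T : ℕ} (w : Fin T → G) (j : Fin T) : wordExt w (j : ℕ) = w j := by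
  rw [wordExt_of_mem w (by omega) (by exact_mod_cast j.2)]
  simp

theorem wordExt_wordRestr {T : ℕ} (x : ℤ → G) {i : ℤ} (h0 : 0 ≤ i) (h1 : i < T) :
    wordExt (wordRestr T x) i = x i := by
  rw [wordExt_of_mem _ h0 h1, wordRestr]
  simp [h0]

theorem wordExt_add {T : ℕ} (v w : Fin T → G) : wordExt (v + w) = wordExt v + wordExt w := by
  ext i
  simp only [wordExt, Pi.add_apply]
  split_ifs <;> simp

theorem wordExt_eq_of_wordRel {T t : ℕ} {v w : Fin T → G} (h : wordRel G T t v w) {i : ℤ}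
    (h0 : 0 ≤ i) (h1 : i < t) : wordExt v i = wordExt w i := by
  simp only [wordExt]
  split_ifs with h2
  · exact h _ (by simp; omega)
  · rfl

variable [Fintype G] [MeasurableSpace G] [MeasurableSingletonClass G] {μ : Measure (ℤ → G)}

theorem measurable_wordRestr (T : ℕ) : Measurable (wordRestr T : (ℤ → G) → Fin T → G) :=
  measurable_pi_lambda _ fun _ => measurable_pi_apply _

theorem clsMass_wordRel [IsProbabilityMeasure μ] {T t : ℕ} (ht : t ≤ T) (w : Fin T → G) :
    clsMass (fun v => mass μ 0 T (wordExt v)) (wordRel G T t) w = mass μ 0 t (wordExt w) := by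
  classical
  have hu : box 0 t (wordExt w) =
      ⋃ v ∈ Finset.univ.filter (fun v => wordRel G T t v w), box 0 T (wordExt v) := by
    ext y
    simp only [Set.mem_iUnion, Finset.mem_filter, Finset.mem_univ, true_and, exists_prop]
    constructor
    · intro hy
      refine ⟨wordRestr T y, fun i hi => ?_, fun i h1 h2 => (wordExt_wordRestr y h1 h2).symm⟩
      rw [← wordExt_coe w]
      exact hy _ (by omega) (by exact_mod_cast hi)
    · rintro ⟨v, hv, hy⟩ i h1 h2
      rw [hy i h1 (by omega), wordExt_eq_of_wordRel hv h1 h2]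
  rw [mass, hu, measureReal_biUnion_finset]
  · rfl
  · intro v _ v' _ hvv
    refine Set.disjoint_left.mpr fun y h1 h2 => hvv ?_
    ext j
    rw [← wordExt_coe v, ← wordExt_coe v', ← h1 _ (by omega) (by exact_mod_cast j.2),
      ← h2 _ (by omega) (by exact_mod_cast j.2)]
  · exact fun _ _ => measurableSet_box _ _ _

theorem sum_mass_wordExt [IsProbabilityMeasure μ] (T : ℕ) :
    ∑ w : Fin T → G, mass μ 0 T (wordExt w) = 1 := by
  classical
  have := clsMass_wordRel (μ := μ) (Nat.zero_le T) (0 : Fin T → G)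
  have hu : box 0 ((0 : ℕ) : ℤ) (wordExt (0 : Fin T → G)) = Set.univ :=
    Set.eq_univ_of_forall fun y i h1 h2 => by push_cast at h2; omega
  rw [mass, hu, probReal_univ] at this
  rw [← this, clsMass]
  refine (Finset.sum_subset (Finset.filter_subset _ _) fun v _ hv => absurd ?_ hv).symm
  exact Finset.mem_filter.mpr ⟨Finset.mem_univ _, fun i hi => absurd hi (Nat.not_lt_zero _)⟩

theorem integral_eq_sum_wordExt [IsProbabilityMeasure μ] {T : ℕ} {F : (ℤ → G) → ℂ}
    (hdep : ∀ x y, (∀ i, 0 ≤ i → i < (T : ℤ) → x i = y i) → F x = F y) :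
    ∫ x, F x ∂μ = ∑ w : Fin T → G, (mass μ 0 T (wordExt w) : ℂ) * F (wordExt w) := by
  have h1 : ∀ x, F x = (fun w => F (wordExt w)) (wordRestr T x) := fun x =>
    hdep _ _ fun i h0 h1 => (wordExt_wordRestr x h0 h1).symm
  have hp : IsProbabilityMeasure (μ.map (wordRestr T)) :=
    Measure.isProbabilityMeasure_map (measurable_wordRestr T).aemeasurable
  rw [integral_congr_ae (ae_of_all _ h1),
    ← integral_map (measurable_wordRestr T).aemeasurable (f := fun w => F (wordExt w))
      (StronglyMeasurable.of_discrete).aestronglyMeasurable,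
    integral_fintype Integrable.of_finite]
  refine Finset.sum_congr rfl fun w _ => ?_
  rw [map_measureReal_apply (measurable_wordRestr T) (measurableSet_singleton w)]
  have : wordRestr T ⁻¹' {w} = box 0 T (wordExt w) := by
    ext y
    constructor
    · rintro rfl i h0 h1
      exact (wordExt_wordRestr y h0 h1).symm
    · intro hy
      ext j
      rw [← wordExt_coe w]
      exact hy _ (by omega) (by exact_mod_cast j.2)
  rw [this, ← mass, Complex.real_smul]

end Words

section Decay

variable {G : Type*} [AddCommGroup G] [Fintype G] [MeasurableSpace G]
  [MeasurableSingletonClass G] {E : Set (G × G)} {μ : Measure (ℤ → G)}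

theorem norm_sub_one_mul_norm_integral_le (hE : EveryLetterOccurs E) (hg : GoodMeasure E μ)
    {e c : ℝ} (he : 1 ≤ e) (hc : 0 < c) {P m : ℕ} (hP : 1 ≤ P)
    (hec : ∀ b d : ℕ, m * P ≤ b → ∀ x ∈ TMC E, ∀ y ∈ TMC E,
      (∀ i, (b : ℤ) - (m * P : ℕ) ≤ i → i < (b + d : ℕ) → x i = y i) →
        mass μ 0 (b + d : ℕ) x * mass μ 0 b y ≤ e * (mass μ 0 (b + d : ℕ) y * mass μ 0 b x))
    (hcm : ∀ x ∈ TMC E, ∀ b d : ℕ, 1 ≤ b → c ^ d * mass μ 0 b x ≤ mass μ 0 (b + d : ℕ) x)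
    {T k : ℕ} (hT : (k + 1 + (m + 1)) * P ≤ T) {F : (ℤ → G) → ℂ} (hF : ∀ x, ‖F x‖ ≤ 1)
    (hmul : ∀ x y, F (x + y) = F x * F y)
    (hdep : ∀ x y, (∀ i, 0 ≤ i → i < (T : ℤ) → x i = y i) → F x = F y)
    {h : ℤ → G} (hh : ∀ x, x ∈ TMC E ↔ x + h ∈ TMC E)
    (hsupp : ∀ i, h i ≠ 0 → (k + 1 : ℤ) * P ≤ i ∧ i < (k + 2 : ℤ) * P) :
    ‖F h - 1‖ * ‖∫ x, F x ∂μ‖ ≤ (e - 1) + (e / c ^ ((m + 1) * P) + 1) *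
      √(clsEnergy (fun w => mass μ 0 T (wordExt w)) (wordRel G T ((k + (m + 1) + 1) * P))
          (fun w => F (wordExt w)) -
        clsEnergy (fun w => mass μ 0 T (wordExt w)) (wordRel G T ((k + 1) * P))
          (fun w => F (wordExt w))) := by
  have hprob := hg.1
  rw [integral_eq_sum_wordExt hdep]
  set p : (Fin T → G) → ℝ := fun w => mass μ 0 T (wordExt w) with hpdef
  set t₁ := (k + 1) * P with ht₁
  set t₂ := (k + (m + 1) + 1) * P with ht₂
  have ht₁₂ : t₂ = t₁ + (m + 1) * P := by rw [ht₁, ht₂]; ring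
  have htT : t₂ ≤ T := by rw [ht₂]; convert hT using 2; ring
  have ht₁pos : 1 ≤ t₁ := Nat.mul_pos (Nat.succ_pos k) hP
  set hr : Fin T → G := wordRestr T h with hhr
  have hsT : ∀ i, h i ≠ 0 → 0 ≤ i ∧ i < T := fun i hi => by
    obtain ⟨h1, h2⟩ := hsupp i hi
    have h3 : ((k + 2 : ℕ) * P : ℕ) ≤ T := (Nat.mul_le_mul_right P (by omega)).trans hT
    have h4 : (((k + 2) * P : ℕ) : ℤ) ≤ T := by exact_mod_cast h3
    push_cast at h4
    exact ⟨le_trans (by positivity) h1, h2.trans_le h4⟩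
  have hext : wordExt hr = h := by
    ext i
    by_cases hi : 0 ≤ i ∧ i < T
    · exact wordExt_wordRestr h hi.1 hi.2
    · rw [wordExt, dif_neg hi]
      by_contra hcon
      exact hi (hsT i (Ne.symm hcon))
  set τ : (Fin T → G) ≃ (Fin T → G) := Equiv.addRight hr with hτdef
  have hτe : ∀ w, wordExt (τ w) = wordExt w + h := fun w => by
    rw [hτdef, Equiv.coe_addRight, wordExt_add, hext]
  have hp0 : ∀ w, 0 ≤ p w := fun w => mass_nonneg _ _ _
  -- positive words are restrictions of admissible points
  have hpt : ∀ w, 0 < p w → ∃ y ∈ TMC E, ∀ t : ℕ, t ≤ T →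
      mass μ 0 t (wordExt w) = mass μ 0 t y ∧ mass μ 0 t (wordExt (τ w)) = mass μ 0 t (y + h) := by
    intro w hw
    obtain ⟨y, hy, hyw⟩ := ((mass_pos_iff hE hg).mp hw).exists_mem_TMC hE
    refine ⟨y, hy, fun t ht => ⟨mass_congr fun i h1 h2 => (hyw i h1 (by omega)).symm,
      mass_congr fun i h1 h2 => ?_⟩⟩
    rw [hτe, Pi.add_apply, Pi.add_apply, hyw i h1 (by omega)]
  have hzero : ∀ w, p w = 0 → p (τ w) = 0 := by
    intro w hw
    by_contra hcon
    have hpos : 0 < p (τ w) := lt_of_le_of_ne (hp0 _) (Ne.symm hcon)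
    obtain ⟨y, hy, hyw⟩ := ((mass_pos_iff hE hg).mp hpos).exists_mem_TMC hE
    have hy' : y - h ∈ TMC E := (hh _).mpr (by rwa [sub_add_cancel])
    have : 0 < p w := (mass_pos_iff hE hg).mpr <|
      (admissible_of_mem_TMC hy' 0 T).congr fun i h1 h2 => by
        rw [Pi.sub_apply, hyw i h1 h2, hτe, Pi.add_apply, add_sub_cancel_right]
    exact this.ne' hw
  have hcls : ∀ w, clsMass p (wordRel G T t₂) w = mass μ 0 t₂ (wordExt w) :=
    fun w => clsMass_wordRel htT w
  have hb : m * P ≤ t₂ := Nat.mul_le_mul_right P (by omega)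
  have hfar : ∀ i, (t₂ : ℤ) - (m * P : ℕ) ≤ i → h i = 0 := fun i hi => by
    by_contra hcon
    have := (hsupp i hcon).2
    rw [ht₂] at hi
    push_cast at hi
    nlinarith
  have hA : ∀ v, p (τ v) * clsMass p (wordRel G T t₂) v ≤
        e * (clsMass p (wordRel G T t₂) (τ v) * p v) ∧
      p v * clsMass p (wordRel G T t₂) (τ v) ≤
        e * (clsMass p (wordRel G T t₂) v * p (τ v)) := by
    intro v
    rcases (hp0 v).eq_or_lt with h0 | h0
    · rw [hzero v h0.symm, ← h0]; simp
    obtain ⟨y, hy, hym⟩ := hpt v h0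
    obtain ⟨d, hd⟩ := Nat.exists_eq_add_of_le htT
    have hy' := (hh y).mp hy
    have r1 := hec t₂ d hb _ hy' _ hy fun i h1 _ => by
      rw [Pi.add_apply, hfar i h1, add_zero]
    have r2 := hec t₂ d hb _ hy _ hy' fun i h1 _ => by
      rw [Pi.add_apply, hfar i h1, add_zero]
    rw [hcls, hcls, hpdef]
    dsimp only
    rw [(hym T le_rfl).1, (hym T le_rfl).2, (hym t₂ htT).1, (hym t₂ htT).2]
    rw [← hd] at r1 r2
    constructor <;> linarith
  refine norm_sub_one_mul_norm_sum_le (p := p) (τ := τ) (r := wordRel G T t₁)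
    (r' := wordRel G T t₂) hp0 (sum_mass_wordExt T)
    (fun v w hvw i hi => hvw i (by rw [ht₁₂]; omega)) (fun w i hi => ?_) (by positivity)
    (fun w => ?_) (fun w hw => ?_)
  · have : h (i : ℕ) = 0 := by
      by_contra hcon
      have h1 := (hsupp _ hcon).1
      have h2 : ((i : ℕ) : ℤ) < (t₁ : ℕ) := by exact_mod_cast hi
      rw [ht₁] at h2
      push_cast at h2
      exact absurd h2 h1.not_gt
    change w i + h (i : ℕ) = w i
    rw [this, add_zero]
  · rcases (hp0 w).eq_or_lt with h0 | h0
    · rw [← h0]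
      exact mul_nonneg (by positivity) (hp0 _)
    obtain ⟨y, hy, hym⟩ := hpt w h0
    have h1 := (hA w).2
    rw [hcls, hcls, (hym t₂ htT).1, (hym t₂ htT).2] at h1
    have h2 := hcm _ ((hh y).mp hy) t₁ ((m + 1) * P) ht₁pos
    rw [← ht₁₂] at h2
    have h3 : mass μ 0 t₁ (y + h) = mass μ 0 t₁ y := mass_congr fun i h1 h2 => by
      rw [Pi.add_apply]
      have : h i = 0 := by
        by_contra hcon
        have h3 := (hsupp _ hcon).1
        rw [ht₁] at h2
        push_cast at h2
        exact absurd h2 h3.not_gt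
      rw [this, add_zero]
    have h4 : mass μ 0 t₂ y ≤ mass μ 0 t₁ y := mass_mono le_rfl (by omega) y
    have h5 : 0 < mass μ 0 t₂ y := (mass_pos_iff hE hg).mpr (admissible_of_mem_TMC hy _ _)
    rw [div_mul_eq_mul_div, le_div_iff₀ (by positivity)]
    refine le_of_mul_le_mul_right ?_ h5
    calc p w * c ^ ((m + 1) * P) * mass μ 0 t₂ y
        ≤ p w * (c ^ ((m + 1) * P) * mass μ 0 t₁ (y + h)) := by
          rw [h3, mul_assoc]; gcongr
      _ ≤ p w * mass μ 0 t₂ (y + h) := by gcongr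
      _ ≤ _ := h1
      _ = _ := by ring
  · have hw' : 0 < p (τ w) := by
      refine lt_of_le_of_ne (hp0 _) fun h0 => ?_
      obtain ⟨y, hy, hym⟩ := hpt w hw
      have : 0 < mass μ 0 T (y + h) :=
        (mass_pos_iff hE hg).mpr (admissible_of_mem_TMC ((hh y).mp hy) _ _)
      rw [← (hym T le_rfl).2] at this
      exact this.ne h0
    have hrel : ∀ v w, wordRel G T t₂ (τ v) (τ w) ↔ wordRel G T t₂ v w := fun v w =>
      forall_congr' fun i => imp_congr_right fun _ => add_left_inj (hr i)
    refine norm_clsAvg_comp_sub_le hp0 (fun w => hF _) (hF h) (fun w => ?_) hrel he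
      (hw.trans_le (le_clsMass hp0 w)) (hw'.trans_le (le_clsMass hp0 _)) (fun v hv => ?_)
      fun v hv => ?_
    · rw [hτe, hmul, mul_comm]
    · rw [← clsMass_congr hv, ← clsMass_congr ((hrel v w).mpr hv)]
      exact (hA v).1
    · rw [← clsMass_congr hv, ← clsMass_congr ((hrel v w).mpr hv)]
      exact (hA v).2

/-- A multiplicative function acting nontrivially on many consecutive blocks of length `P` has
small integral. -/
theorem CCSD.exists_norm_integral_le (hE : EveryLetterOccurs E) (hg : GoodMeasure E μ)
    (hμ : CCSD E μ) {P : ℕ} (hP : 1 ≤ P) {c₀ ε : ℝ} (hc₀ : 0 < c₀) (hε : 0 < ε) :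
    ∃ R : ℕ, ∀ (T : ℕ) (F : (ℤ → G) → ℂ), (∀ x, ‖F x‖ ≤ 1) → (∀ x y, F (x + y) = F x * F y) →
      (∀ x y, (∀ i, 0 ≤ i → i < (T : ℤ) → x i = y i) → F x = F y) →
      ∀ S : Finset ℕ, R ≤ S.card →
        (∀ k ∈ S, ∃ h : ℤ → G, (∀ x, x ∈ TMC E ↔ x + h ∈ TMC E) ∧
          (∀ i, h i ≠ 0 → (k + 1 : ℤ) * P ≤ i ∧ i < (k + 2 : ℤ) * P) ∧ c₀ ≤ ‖F h - 1‖) →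
        ‖∫ x, F x ∂μ‖ ≤ ε := by
  have hprob := hg.1
  obtain ⟨e, he1, he, hec⟩ := hμ.exists_ratio hE hg
  obtain ⟨c, hc, -, hcm⟩ := hμ.exists_mul_mass_le hE hg
  obtain ⟨m, hm1, hm⟩ : ∃ m : ℕ, 1 ≤ m ∧ e (m * P) - 1 < c₀ * ε / 2 := by
    have h1 : Tendsto (fun m : ℕ => e (m * P)) atTop (𝓝 1) :=
      he1.comp (tendsto_id.atTop_mul_const' (Nat.pos_of_ne_zero (by omega)))
    have h2 := (h1.eventually_lt_const (show (1 : ℝ) < 1 + c₀ * ε / 2 by linarith [mul_pos hc₀ hε]))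
    obtain ⟨m, h3, h4⟩ := (h2.and (eventually_ge_atTop 1)).exists
    exact ⟨m, h4, by linarith⟩
  set C : ℝ := e (m * P) / c ^ ((m + 1) * P) + 1 with hC
  have hCpos : 0 < C := by have := he (m * P); positivity
  obtain ⟨R, hR⟩ := exists_nat_ge ((m + 1 : ℕ) / (c₀ * ε / (2 * C)) ^ 2)
  refine ⟨max R 1, fun T F hF hmul hdep S hS hSh => ?_⟩
  have hScard : 1 ≤ S.card := (le_max_right _ _).trans hS
  have hSR : (R : ℝ) ≤ S.card := by exact_mod_cast (le_max_left _ _).trans hS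
  obtain ⟨N, hN⟩ := S.exists_nat_subset_range
  set T' := T + (N + 1 + (m + 1)) * P with hT'
  set en : ℕ → ℝ := fun k => clsEnergy (fun w => mass μ 0 T' (wordExt w))
    (wordRel G T' ((k + 1) * P)) (fun w => F (wordExt w)) with hen
  have hp0 : ∀ w : Fin T' → G, 0 ≤ mass μ 0 T' (wordExt w) := fun w => mass_nonneg _ _ _
  obtain ⟨k, hkS, hk⟩ := exists_increment_le (e := en)
    (fun a b hab => clsEnergy_mono hp0 fun v w hvw i hi =>
      hvw i (hi.trans_le (Nat.mul_le_mul_right P (by omega))))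
    (fun k => clsEnergy_nonneg hp0)
    (fun k => clsEnergy_le_one hp0 (sum_mass_wordExt T') fun w => hF _) (m + 1)
    (Finset.card_pos.mp hScard)
  obtain ⟨h, hh, hsupp, hch⟩ := hSh k hkS
  have hkN : k < N := Finset.mem_range.mp (hN hkS)
  have key := norm_sub_one_mul_norm_integral_le hE hg (he (m * P)) hc hP
    (fun b d hb x hx y hy hxy => hec (m * P) b d (Nat.mul_pos hm1 hP) hb x hx y hy hxy) hcm
    (T := T') (k := k)
    ((Nat.mul_le_mul_right P (by omega)).trans (Nat.le_add_left _ _)) hF hmul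
    (fun x y hxy => hdep x y fun i h0 h1 => hxy i h0 (by rw [hT']; push_cast; nlinarith)) hh hsupp
  have hsqrt : √(en (k + (m + 1)) - en k) ≤ c₀ * ε / (2 * C) := by
    refine Real.sqrt_le_iff.mpr ⟨by positivity, hk.trans ?_⟩
    rw [div_le_iff₀ (by exact_mod_cast hScard)]
    rw [div_le_iff₀ (by positivity)] at hR
    refine hR.trans ?_
    rw [mul_comm]
    gcongr
  have h1 : C * √(en (k + (m + 1)) - en k) ≤ c₀ * ε / 2 := by
    calc C * √(en (k + (m + 1)) - en k) ≤ C * (c₀ * ε / (2 * C)) := by gcongr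
      _ = c₀ * ε / 2 := by field_simp
  have h2 : c₀ * ‖∫ x, F x ∂μ‖ ≤ c₀ * ε := by
    refine (mul_le_mul_of_nonneg_right hch (norm_nonneg _)).trans (key.trans ?_)
    linarith
  exact le_of_mul_le_mul_left h2 hc₀

end Decay

/-! ### The Haar measure on a coset of a path subgroup -/

section Haar

variable {G : Type*} [Fintype G] [AddCommGroup G] [TopologicalSpace G] [DiscreteTopology G]
  [MeasurableSpace G] [MeasurableSingletonClass G]

theorem borelSpace_of_finite_discrete : BorelSpace G :=
  ⟨by rw [borel_eq_top_of_discrete]; exact eq_top_iff.mpr fun s _ => s.toFinite.measurableSet⟩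

theorem isClosed_pathSubgroup (K : AddSubgroup (G × G)) :
    IsClosed (pathSubgroup K : Set (ℤ → G)) := by
  have : (pathSubgroup K : Set (ℤ → G)) = ⋂ i : ℤ, (fun h : ℤ → G => (h i, h (i + 1))) ⁻¹' K := by
    ext h
    simp [mem_pathSubgroup]
  rw [this]
  exact isClosed_iInter fun i => (isClosed_discrete _).preimage (by fun_prop)

/-- The shift as an endomorphism of the path subgroup. -/
def shiftHom (K : AddSubgroup (G × G)) : pathSubgroup K →+ pathSubgroup K where
  toFun h := ⟨shiftMap h.1, fun i => h.2 (i + 1)⟩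
  map_zero' := rfl
  map_add' _ _ := rfl

theorem exists_coset_haar (K : AddSubgroup (G × G)) (g : G) :
    ∃ κ : Measure (ℤ → G), IsProbabilityMeasure κ ∧ Measure.map shiftMap κ = κ ∧
      (∀ᵐ x ∂κ, (fun i => x i - g) ∈ pathSubgroup K) ∧
      ∀ h ∈ pathSubgroup K, MeasurePreserving (fun x => x + h) κ κ := by
  have : BorelSpace G := borelSpace_of_finite_discrete
  have : CompactSpace (pathSubgroup K) :=
    isCompact_iff_compactSpace.mp (isClosed_pathSubgroup K).isCompact
  let K₀ : TopologicalSpace.PositiveCompacts (pathSubgroup K) := ⊤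
  let ν : Measure (pathSubgroup K) := Measure.addHaarMeasure K₀
  have hν : IsProbabilityMeasure ν := ⟨Measure.addHaarMeasure_self (K₀ := K₀)⟩
  have hf : Measurable fun h : pathSubgroup K => fun i => g + h.1 i :=
    measurable_pi_lambda _ fun i =>
      (measurable_of_finite (fun a : G => g + a)).comp
        ((measurable_pi_apply i).comp measurable_subtype_coe)
  refine ⟨ν.map fun h => fun i => g + h.1 i, Measure.isProbabilityMeasure_map hf.aemeasurable,
    ?_, ?_, fun h hh => ⟨measurable_add_const h, ?_⟩⟩
  · have hs : MeasurePreserving (shiftHom K) ν ν := by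
      refine AddMonoidHom.measurePreserving ?_ (fun h => ?_) rfl
      · exact Continuous.subtype_mk (continuous_pi fun i =>
          (continuous_apply (A := fun _ => G) (i + 1)).comp continuous_subtype_val) _
      · refine ⟨⟨fun i => h.1 (i - 1), fun i => ?_⟩, ?_⟩
        · have := h.2 (i - 1)
          rw [sub_add_cancel] at this
          simpa using this
        · ext i
          change h.1 (i + 1 - 1) = h.1 i
          rw [add_sub_cancel_right]
    rw [Measure.map_map (show Measurable shiftMap from measurable_shiftBy 1) hf]
    conv_rhs => rw [← hs.map_eq, Measure.map_map hf hs.measurable]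
    rfl
  · rw [ae_map_iff hf.aemeasurable]
    · refine ae_of_all _ fun h => ?_
      simpa only [add_sub_cancel_left] using h.2
    · exact (((isClosed_pathSubgroup K).preimage (f := fun (x : ℤ → G) i => x i - g)
        (by fun_prop))).measurableSet
  · rw [Measure.map_map (measurable_add_const h) hf]
    conv_rhs => rw [← map_add_right_eq_self ν ⟨h, hh⟩, Measure.map_map hf (measurable_add_const _)]
    congr 1
    ext x i
    simp [add_assoc]

end Haar

/-! ### The Haar measure is the Parry measure -/

section Parry

variable {G : Type*} [Fintype G] [AddCommGroup G] {E : Set (G × G)} {K : AddSubgroup (G × G)}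
  {g : G}

theorem mem_edge_add_iff (hK : ∀ a b, (a, b) ∈ K ↔ (g + a, g + b) ∈ E) {a b a' b' : G}
    (h : (a, b) ∈ K) : (a' + a, b' + b) ∈ E ↔ (a', b') ∈ E := by
  have key : ∀ a b, (a, b) ∈ E ↔ (a - g, b - g) ∈ K := fun a b => by
    rw [hK, add_sub_cancel, add_sub_cancel]
  rw [key, key, show (a' + a - g, b' + b - g) = (a' - g, b' - g) + (a, b) by
    ext <;> simp <;> abel]
  exact K.add_mem_cancel_right h

theorem mem_TMC_add_iff (hK : ∀ a b, (a, b) ∈ K ↔ (g + a, g + b) ∈ E) {h : ℤ → G}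
    (hh : h ∈ pathSubgroup K) (x : ℤ → G) : x ∈ TMC E ↔ x + h ∈ TMC E :=
  forall_congr' fun i => (mem_edge_add_iff hK (hh i)).symm

theorem sub_mem_pathSubgroup (hK : ∀ a b, (a, b) ∈ K ↔ (g + a, g + b) ∈ E) {x y : ℤ → G}
    (hx : x ∈ TMC E) (hy : y ∈ TMC E) : y - x ∈ pathSubgroup K := fun i => by
  have key : ∀ z ∈ TMC E, (z i - g, z (i + 1) - g) ∈ K := fun z hz => by
    rw [hK, add_sub_cancel, add_sub_cancel]
    exact hz i
  have := K.sub_mem (key y hy) (key x hx)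
  simpa using this

theorem mem_TMC_iff_sub_mem (hK : ∀ a b, (a, b) ∈ K ↔ (g + a, g + b) ∈ E) {x : ℤ → G} :
    x ∈ TMC E ↔ (fun i => x i - g) ∈ pathSubgroup K :=
  forall_congr' fun i => by rw [hK, add_sub_cancel, add_sub_cancel]

theorem sum_follower_indicator (hE : EveryLetterOccurs E)
    (hK : ∀ a b, (a, b) ∈ K ↔ (g + a, g + b) ∈ E) (a : G) :
    ∑ b, E.indicator (fun _ => (1 : ℝ)) (a, b) = ∑ b, E.indicator (fun _ => (1 : ℝ)) (g, b) := by
  classical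
  obtain ⟨x, hx, rfl⟩ := exists_TMC_at hE a 0
  refine (Fintype.sum_equiv (Equiv.addRight (x 1 - g)) _ _ fun b => ?_).symm
  have h : (x 0 - g, x 1 - g) ∈ K := (mem_TMC_iff_sub_mem hK).mp hx 0
  have := mem_edge_add_iff hK (a' := g) (b' := b) h
  rw [add_sub_cancel] at this
  simp only [Set.indicator_apply, Equiv.coe_addRight, this]

theorem sum_predecessor_indicator (hE : EveryLetterOccurs E)
    (hK : ∀ a b, (a, b) ∈ K ↔ (g + a, g + b) ∈ E) (b : G) :
    ∑ a, E.indicator (fun _ => (1 : ℝ)) (a, b) = ∑ a, E.indicator (fun _ => (1 : ℝ)) (a, g) := by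
  classical
  obtain ⟨x, hx, rfl⟩ := exists_TMC_at hE b 1
  refine (Fintype.sum_equiv (Equiv.addRight (x 0 - g)) _ _ fun b => ?_).symm
  have h : (x 0 - g, x 1 - g) ∈ K := (mem_TMC_iff_sub_mem hK).mp hx 0
  have := mem_edge_add_iff hK (a' := b) (b' := g) h
  rw [add_sub_cancel] at this
  simp only [Set.indicator_apply, Equiv.coe_addRight, this]

theorem sum_follower_eq_sum_predecessor (hE : EveryLetterOccurs E)
    (hK : ∀ a b, (a, b) ∈ K ↔ (g + a, g + b) ∈ E) :
    ∑ b, E.indicator (fun _ => (1 : ℝ)) (g, b) = ∑ a, E.indicator (fun _ => (1 : ℝ)) (a, g) := by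
  have h := Finset.sum_comm (s := Finset.univ) (t := Finset.univ)
    (f := fun a b : G => E.indicator (fun _ => (1 : ℝ)) (a, b))
  simp only [sum_follower_indicator hE hK, sum_predecessor_indicator hE hK, Finset.sum_const,
    Finset.card_univ, nsmul_eq_mul] at h
  exact mul_left_cancel₀ (by exact_mod_cast (Fintype.card_pos_iff.mpr ⟨g⟩).ne') h

variable [MeasurableSpace G] [MeasurableSingletonClass G] {κ : Measure (ℤ → G)}

theorem mass_eq_zero_of_not_admissible (hT : ∀ᵐ x ∂κ, x ∈ TMC E) {a b : ℤ} {x : ℤ → G}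
    (hx : ¬ Admissible E a b x) : mass κ a b x = 0 := by
  have h : κ (box a b x) = 0 := measure_mono_null (fun y hy hyT => hx
    ((admissible_of_mem_TMC hyT a b).congr hy)) hT
  rw [mass, measureReal_def, h, ENNReal.toReal_zero]

theorem mass_eq_of_admissible (hE : EveryLetterOccurs E)
    (hK : ∀ a b, (a, b) ∈ K ↔ (g + a, g + b) ∈ E)
    (htr : ∀ h ∈ pathSubgroup K, MeasurePreserving (fun x => x + h) κ κ) {a b : ℤ}
    {x y : ℤ → G} (hx : Admissible E a b x) (hy : Admissible E a b y) :
    mass κ a b x = mass κ a b y := by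
  obtain ⟨x', hx', hxx⟩ := hx.exists_mem_TMC hE
  obtain ⟨y', hy', hyy⟩ := hy.exists_mem_TMC hE
  rw [← mass_congr hxx, ← mass_congr hyy, mass, mass,
    ← (htr _ (sub_mem_pathSubgroup hK hx' hy')).measureReal_preimage
      (measurableSet_box a b y').nullMeasurableSet]
  congr 1
  ext z
  refine forall_congr' fun i => imp_congr_right fun _ => imp_congr_right fun _ => ?_
  change z i = x' i ↔ z i + (y' i - x' i) = y' i
  rw [add_sub_left_comm, add_eq_left, sub_eq_zero]

theorem mass_eq_sum_predecessor_mul [IsProbabilityMeasure κ] (hE : EveryLetterOccurs E)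
    (hK : ∀ a b, (a, b) ∈ K ↔ (g + a, g + b) ∈ E) (hT : ∀ᵐ x ∂κ, x ∈ TMC E)
    (htr : ∀ h ∈ pathSubgroup K, MeasurePreserving (fun x => x + h) κ κ) {a b : ℤ} (hab : a < b)
    {x : ℤ → G} (hx : x ∈ TMC E) :
    mass κ a b x = (∑ z, E.indicator (fun _ => (1 : ℝ)) (z, g)) * mass κ (a - 1) b x := by
  classical
  rw [mass_eq_sum_update a b hab.le, ← sum_predecessor_indicator hE hK (x a), Finset.sum_mul]
  refine Finset.sum_congr rfl fun z _ => ?_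
  have hiff : Admissible E (a - 1) b (Function.update x (a - 1) z) ↔ (z, x a) ∈ E := by
    constructor
    · intro h
      have := h (a - 1) le_rfl (by omega)
      rwa [Function.update_self, sub_add_cancel, Function.update_of_ne (by omega)] at this
    · intro h i h1 h2
      rcases h1.eq_or_lt with rfl | h1
      · rwa [Function.update_self, sub_add_cancel, Function.update_of_ne (by omega)]
      · rw [Function.update_of_ne (by omega), Function.update_of_ne (by omega)]
        exact hx i
  by_cases hz : (z, x a) ∈ E
  · rw [Set.indicator_of_mem hz, one_mul]
    exact mass_eq_of_admissible hE hK htr (hiff.mpr hz) (admissible_of_mem_TMC hx _ _)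
  · rw [Set.indicator_of_notMem hz, zero_mul]
    exact mass_eq_zero_of_not_admissible hT (mt hiff.mp hz)

theorem isParryMeasure_of_invariant [IsProbabilityMeasure κ] (hE : EveryLetterOccurs E)
    (hg : (g, g) ∈ E) (hK : ∀ a b, (a, b) ∈ K ↔ (g + a, g + b) ∈ E)
    (hκ : Measure.map shiftMap κ = κ) (hT : ∀ᵐ x ∂κ, x ∈ TMC E)
    (htr : ∀ h ∈ pathSubgroup K, MeasurePreserving (fun x => x + h) κ κ) :
    IsParryMeasure E κ := by
  classical
  set d : ℝ := ∑ a, E.indicator (fun _ => (1 : ℝ)) (a, g) with hd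
  have hd0 : 0 < d := Finset.sum_pos' (fun a _ => Set.indicator_nonneg (fun _ _ => zero_le_one) _)
    ⟨g, Finset.mem_univ g, by rw [Set.indicator_of_mem hg]; exact one_pos⟩
  have hG : (0 : ℝ) < Fintype.card G := by exact_mod_cast Fintype.card_pos_iff.mpr ⟨g⟩
  have hind : ∀ e : G × G, E.indicator (fun _ => (Fintype.card G : ℝ)⁻¹) e =
      E.indicator (fun _ => (1 : ℝ)) e * (Fintype.card G : ℝ)⁻¹ := fun e => by
    simp only [Set.indicator_apply]
    split_ifs <;> simp
  refine ⟨inferInstance, hκ, d, fun _ => 1, fun _ => (Fintype.card G : ℝ)⁻¹, hd0,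
    fun _ => one_pos, fun _ => by positivity, fun a => ?_, fun b => ?_, ?_, fun m w hw => ?_⟩
  · rw [mul_one, sum_follower_indicator hE hK, sum_follower_eq_sum_predecessor hE hK]
  · simp only [hind]
    rw [← Finset.sum_mul, sum_predecessor_indicator hE hK]
  · simp [hG.ne']
  obtain ⟨x, hx, j, hj⟩ := hw
  have hx' := TMC_shift hx j
  have hc : cyl w = box 0 (m + 1 : ℕ) (fun i => x (i + j)) :=
    cyl_eq_box fun i => by rw [← hj, add_comm]
  have hbase : ∀ y : ℤ → G, mass κ 0 1 y = (Fintype.card G : ℝ)⁻¹ := fun y => by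
    have hadm : ∀ z : ℤ → G, Admissible E 0 1 z := fun z i h1 h2 => by omega
    have h1 := mass_eq_sum_update (μ := κ) 1 1 le_rfl y
    rw [sub_self, Finset.sum_congr rfl fun z _ =>
      mass_eq_of_admissible hE hK htr (hadm (Function.update y 0 z)) (hadm y), Finset.sum_const,
      Finset.card_univ, nsmul_eq_mul, mass,
      show box 1 1 y = Set.univ from Set.eq_univ_of_forall fun z i h1 h2 => by omega,
      probReal_univ] at h1
    exact eq_inv_of_mul_eq_one_right h1.symm
  have hmass : ∀ (n : ℕ), ∀ y ∈ TMC E, mass κ (-(n : ℤ)) 1 y = (Fintype.card G : ℝ)⁻¹ / d ^ n := by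
    intro n
    induction n with
    | zero => intro y _; simpa using hbase y
    | succ n ih =>
      intro y hy
      have h1 := mass_eq_sum_predecessor_mul hE hK hT htr (a := -(n : ℤ)) (b := 1) (by omega) hy
      rw [ih y hy, ← hd] at h1
      rw [show -((n + 1 : ℕ) : ℤ) = -(n : ℤ) - 1 by push_cast; ring, pow_succ, ← div_div, h1]
      field_simp
  rw [hc, mul_one, ← hmass m _ (TMC_shift hx (j + m)), ← measureReal_def, ← mass,
    show (fun i => x (i + j)) = fun i => (fun i' => x (i' + (j + m))) (i + -(m : ℤ)) by
      ext i; exact congrArg x (by ring),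
    mass_shift hκ 0 ((m + 1 : ℕ) : ℤ) (-(m : ℤ)) (fun i => x (i + (j + m))), zero_add, show ((m + 1 : ℕ) : ℤ) + -(m : ℤ) = 1 by push_cast; ring]

end Parry

/-! ### Cesàro bounds -/

theorem sum_range_le_of_le {a : ℕ → ℝ} (ha1 : ∀ n, a n ≤ 1) {P C : ℕ} {ε : ℝ} (hε : 0 ≤ ε)
    (h : ∀ m < P, C + m ≤ P → a m ≤ ε) : ∑ m ∈ Finset.range P, a m ≤ P * ε + C := by
  have h1 : ∀ m ∈ Finset.range P, a m ≤ ε + if P < C + m then 1 else 0 := fun m hm => by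
    split_ifs with hlt
    · linarith [ha1 m]
    · linarith [h m (Finset.mem_range.mp hm) (by omega)]
  refine (Finset.sum_le_sum h1).trans ?_
  rw [Finset.sum_add_distrib, Finset.sum_const, Finset.card_range, nsmul_eq_mul,
    ← Finset.sum_filter, Finset.sum_const, nsmul_eq_mul, mul_one]
  have h2 : ((Finset.range P).filter fun m => P < C + m) ⊆ Finset.Ico (P - C) P := fun m hm => by
    rw [Finset.mem_filter, Finset.mem_range] at hm
    rw [Finset.mem_Ico]
    omega
  have h3 := Finset.card_le_card h2
  rw [Nat.card_Ico] at h3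
  have h4 : (((Finset.range P).filter fun m => P < C + m).card : ℝ) ≤ C := by
    exact_mod_cast h3.trans (by omega)
  linarith

theorem exists_sum_range_le {a : ℕ → ℝ} (ha0 : ∀ n, 0 ≤ a n) (ha1 : ∀ n, a n ≤ 1) {p : ℕ}
    (hp : p.Prime) {P C j : ℕ} (hP : 0 < P) {ε : ℝ} (hε : 0 < ε) (hC : C ≤ ε * P)
    (h : ∀ n m, m < P → C + m ≤ P → 2 ^ j ≤ (unitBinomials p n).card → a (m + P * n) ≤ ε) :
    ∃ B : ℝ, ∀ N : ℕ, ∑ n ∈ Finset.range N, a n ≤ 3 * ε * N + B := by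
  obtain ⟨B, hB0, hB⟩ := exists_fewUnits_le hp j ε hε
  refine ⟨3 * ε * P + P * B, fun N => ?_⟩
  set M := N / P + 1
  have hNM : N ≤ P * M := (Nat.lt_mul_div_succ N hP).le
  have hMN : (P : ℝ) * M ≤ N + P := by
    have : P * M ≤ N + P := by rw [mul_add_one]; exact Nat.add_le_add_right (Nat.mul_div_le N P) P
    exact_mod_cast this
  have hP' : (0 : ℝ) < P := by exact_mod_cast hP
  have hrow : ∀ n, ∑ m ∈ Finset.range P, a (P * n + m) ≤
      2 * ε * P + P * if (unitBinomials p n).card < 2 ^ j then (1 : ℝ) else 0 := fun n => by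
    split_ifs with hn
    · refine (Finset.sum_le_sum fun m _ => ha1 _).trans ?_
      rw [Finset.sum_const, Finset.card_range, nsmul_eq_mul]
      have : 0 ≤ 2 * ε * P := by positivity
      linarith
    · refine (sum_range_le_of_le (fun m => ha1 _) hε.le fun m hm hCm => ?_).trans
        (by linarith : (P : ℝ) * ε + C ≤ _)
      rw [add_comm]
      exact h n m hm hCm (not_lt.mp hn)
  calc ∑ n ∈ Finset.range N, a n ≤ ∑ n ∈ Finset.range (P * M), a n :=
        Finset.sum_le_sum_of_subset_of_nonneg (Finset.range_mono hNM) fun n _ _ => ha0 n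
    _ = ∑ n ∈ Finset.range M, ∑ m ∈ Finset.range P, a (P * n + m) := sum_range_mul_eq a P M
    _ ≤ _ := Finset.sum_le_sum fun n _ => hrow n
    _ = 2 * ε * (P * M) + P * fewUnits p (2 ^ j) M := by
      rw [Finset.sum_add_distrib, fewUnits, Finset.mul_sum, Finset.sum_const,
        Finset.card_range, nsmul_eq_mul]
      ring
    _ ≤ 2 * ε * (P * M) + P * (ε * M + B) := by
      have := hB M
      gcongr
    _ = 3 * ε * (P * M) + P * B := by ring
    _ ≤ 3 * ε * (N + P) + P * B := by gcongr
    _ = _ := by ring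

theorem tendsto_cesaro_zero {z : ℕ → ℂ}
    (h : ∀ ε : ℝ, 0 < ε → ∃ B : ℝ, ∀ N : ℕ, ∑ n ∈ Finset.range N, ‖z n‖ ≤ ε * N + B) :
    Tendsto (fun N : ℕ => (N : ℂ)⁻¹ * ∑ n ∈ Finset.range N, z n) atTop (𝓝 0) := by
  rw [Metric.tendsto_atTop]
  intro ε hε
  obtain ⟨B, hB⟩ := h (ε / 2) (half_pos hε)
  obtain ⟨N₀, hN₀⟩ := exists_nat_gt (B / (ε / 2))
  refine ⟨N₀ + 1, fun N hN => ?_⟩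
  have hNpos : (0 : ℝ) < N := by exact_mod_cast (Nat.succ_pos _).trans_le hN
  have hNB : B < ε / 2 * N := by
    rw [div_lt_iff₀ (half_pos hε)] at hN₀
    have : (N₀ : ℝ) ≤ N := by exact_mod_cast (Nat.le_succ _).trans hN
    nlinarith
  rw [dist_zero_right, norm_mul, norm_inv, Complex.norm_natCast, inv_mul_lt_iff₀ hNpos]
  linarith [norm_sum_le (Finset.range N) z, hB N]

theorem exists_le_norm_sub_one {N : ℕ} (hN : 0 < N) :
    ∃ c : ℝ, 0 < c ∧ ∀ z : ℂ, z ^ N = 1 → z ≠ 1 → c ≤ ‖z - 1‖ := by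
  have hfin : {z : ℂ | z ^ N = 1 ∧ z ≠ 1}.Finite := by
    refine (Polynomial.nthRoots N (1 : ℂ)).toFinset.finite_toSet.subset fun z hz => ?_
    simpa [Polynomial.mem_nthRoots hN] using hz.1
  obtain ⟨c, hc, hball⟩ := Metric.isOpen_iff.mp hfin.isClosed.isOpen_compl 1 (by simp)
  refine ⟨c, hc, fun z hz hz1 => ?_⟩
  by_contra! hlt
  exact hball (by rwa [Metric.mem_ball, dist_eq_norm]) ⟨hz, hz1⟩

/-! ### Iterates of affine automata -/

section Iterates

variable {G : Type*} [AddCommGroup G]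

/-- The linear part of an affine automaton. -/
abbrev linCA (η ρ : G ≃+ G) : (ℤ → G) → ℤ → G := CA fun a b => η a + ρ b

variable (η ρ : G ≃+ G)

theorem linCA_iterate_add (n : ℕ) (x y : ℤ → G) :
    (linCA η ρ)^[n] (x + y) = (linCA η ρ)^[n] x + (linCA η ρ)^[n] y := by
  induction n generalizing x y with
  | zero => rfl
  | succ n ih =>
    rw [Function.iterate_succ_apply, Function.iterate_succ_apply, Function.iterate_succ_apply,
      ← ih]
    congr 1
    ext i
    simp only [linCA, CA, Pi.add_apply, map_add]
    abel

theorem CA_iterate_eq_linCA_iterate_add {φ : G → G → G} {c : G}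
    (hφ : ∀ a b, φ a b = η a + ρ b + c) (n : ℕ) (x : ℤ → G) :
    (CA φ)^[n] x = (linCA η ρ)^[n] x + (CA φ)^[n] 0 := by
  induction n with
  | zero => simp
  | succ n ih =>
    rw [Function.iterate_succ_apply', Function.iterate_succ_apply', Function.iterate_succ_apply',
      ih]
    ext i
    simp only [linCA, CA, Pi.add_apply, hφ, map_add]
    abel

theorem linCA_iterate_congr {n : ℕ} {a b : ℤ} {x y : ℤ → G}
    (h : ∀ i, a ≤ i → i < b + n → x i = y i) :
    ∀ i, a ≤ i → i < b → (linCA η ρ)^[n] x i = (linCA η ρ)^[n] y i := by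
  induction n generalizing x y with
  | zero => simpa using h
  | succ n ih =>
    rw [Function.iterate_succ_apply, Function.iterate_succ_apply]
    refine ih fun i h1 h2 => ?_
    simp only [linCA, CA]
    rw [h i h1 (by push_cast; omega), h (i + 1) (by omega) (by push_cast; omega)]

theorem coe_linEnd_pow {K : AddSubgroup (G × G)} (hη : ∀ a b, (η a, η b) ∈ K ↔ (a, b) ∈ K)
    (hρ : ∀ a b, (ρ a, ρ b) ∈ K ↔ (a, b) ∈ K) (n : ℕ) (h : pathSubgroup K) :
    ((linEnd η ρ hη hρ ^ n) h).1 = (linCA η ρ)^[n] h.1 := by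
  induction n generalizing h with
  | zero => rfl
  | succ n ih =>
    rw [pow_succ, End_mul_apply, ih, Function.iterate_succ_apply]
    rfl

theorem CA_mem_TMC {E : Set (G × G)} {φ : G → G → G} (hSC : SC E φ) {x : ℤ → G}
    (hx : x ∈ TMC E) : CA φ x ∈ TMC E :=
  hSC x hx _ (TMC_shift hx 1)

theorem CA_iterate_mem_TMC {E : Set (G × G)} {φ : G → G → G} (hSC : SC E φ) (n : ℕ) {x : ℤ → G}
    (hx : x ∈ TMC E) : (CA φ)^[n] x ∈ TMC E := by
  induction n with
  | zero => exact hx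
  | succ n ih =>
    rw [Function.iterate_succ_apply']
    exact CA_mem_TMC hSC ih

theorem continuous_CA [TopologicalSpace G] [DiscreteTopology G] (φ : G → G → G) :
    Continuous (CA φ) :=
  continuous_pi fun i => Continuous.comp (f := fun x : ℤ → G => (x i, x (i + 1)))
    (g := fun e : G × G => φ e.1 e.2) continuous_of_discreteTopology (by fun_prop)

end Iterates

/-! ### Cesàro means of characters -/

section Characters

variable {G : Type*} [Fintype G] [AddCommGroup G] {E : Set (G × G)} {K : AddSubgroup (G × G)}
  {g : G} [MeasurableSpace G] [MeasurableSingletonClass G] {μ : Measure (ℤ → G)}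

/-- Shifting by `k` as a measurable equivalence. -/
def shiftEquiv (G : Type*) [MeasurableSpace G] (k : ℤ) : (ℤ → G) ≃ᵐ (ℤ → G) where
  toFun x i := x (i + k)
  invFun x i := x (i - k)
  left_inv x := by ext i; simp
  right_inv x := by ext i; simp
  measurable_toFun := measurable_pi_lambda _ fun i => measurable_pi_apply (i + k)
  measurable_invFun := measurable_pi_lambda _ fun i => measurable_pi_apply (i - k)

theorem integral_shift (hμ : Measure.map shiftMap μ = μ) (F : (ℤ → G) → ℂ) (k : ℤ) :
    ∫ x, F (fun i => x (i + k)) ∂μ = ∫ x, F x ∂μ :=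
  (show MeasurePreserving (shiftEquiv G k) μ μ from
    measurePreserving_shiftBy hμ k).integral_comp' F

theorem exists_sum_norm_integral_le (hE : EveryLetterOccurs E) (hgood : GoodMeasure E μ)
    (hμ : CCSD E μ) (hK : ∀ a b, (a, b) ∈ K ↔ (g + a, g + b) ∈ E) {q : ℕ}
    (hq : ConnectsToZero K q) {η ρ : G ≃+ G} (hη : ∀ a b, (η a, η b) ∈ K ↔ (a, b) ∈ K)
    (hρ : ∀ a b, (ρ a, ρ b) ∈ K ↔ (a, b) ∈ K) (hcomm : ∀ a, η (ρ a) = ρ (η a))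
    {F : (ℤ → G) → ℂ} (hF : ∀ x, ‖F x‖ = 1) (hmul : ∀ x y, F (x + y) = F x * F y) {a b : ℤ}
    (hab : a < b) (hdep : ∀ x y, (∀ i, a ≤ i → i < b → x i = y i) → F x = F y)
    (hne : ∃ h ∈ pathSubgroup K, F h ≠ 1) {ε : ℝ} (hε : 0 < ε) :
    ∃ B : ℝ, ∀ N : ℕ,
      ∑ n ∈ Finset.range N, ‖∫ x, F ((linCA η ρ)^[n] x) ∂μ‖ ≤ ε * N + B := by
  have hprob := hgood.1
  have hF0 : ∀ x, F x ≠ 0 := fun x => norm_ne_zero_iff.mp (by rw [hF]; exact one_ne_zero)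
  have hFz : F 0 = 1 := mul_left_cancel₀ (hF0 0) (by rw [← hmul, add_zero, mul_one])
  let χ : pathSubgroup K →+ Additive ℂˣ :=
    { toFun := fun h => Additive.ofMul (Units.mk0 (F h.1) (hF0 _))
      map_zero' := congrArg Additive.ofMul (Units.ext hFz)
      map_add' := fun h h' => congrArg Additive.ofMul (Units.ext (hmul h.1 h'.1)) }
  have hχ : ∀ h, χ h = 0 ↔ F h.1 = 1 := fun h =>
    ⟨fun h0 => congrArg (fun u : Additive ℂˣ => (u.toMul : ℂ)) h0,
      fun h1 => congrArg Additive.ofMul (Units.ext h1)⟩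
  have hχdep : DependsOn χ a b := fun h hz => (hχ h).mpr <| by
    rw [← hFz]
    exact hdep _ _ hz
  have hχ0 : χ ≠ 0 := by
    obtain ⟨h, hh, hh1⟩ := hne
    exact fun h0 => hh1 ((hχ ⟨h, hh⟩).mp (DFunLike.congr_fun h0 _))
  obtain ⟨p, hp, hblock⟩ := exists_block η ρ hη hρ hχdep hab hq hcomm hχ0
  obtain ⟨c₀, hc₀, hroot⟩ := exists_le_norm_sub_one (N := Fintype.card G)
    (Fintype.card_pos_iff.mpr ⟨0⟩)
  have hFroot : ∀ x, F x ≠ 1 → c₀ ≤ ‖F x - 1‖ := fun x hx => by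
    refine hroot _ ?_ hx
    have hpow : ∀ n : ℕ, F x ^ n = F (n • x) := fun n => by
      induction n with
      | zero => rw [pow_zero, zero_nsmul, hFz]
      | succ n ih => rw [pow_succ, ih, succ_nsmul, hmul]
    rw [hpow, ← hFz]
    congr 1
    ext i
    exact card_nsmul_eq_zero
  set ε' := ε / 3 with hε'
  have hε'0 : 0 < ε' := by positivity
  set C : ℕ := (b - a + 2 * q).toNat with hC
  obtain ⟨s, hs⟩ : ∃ s : ℕ, (C : ℝ) ≤ ε' * (p ^ s : ℕ) := by
    obtain ⟨s, hs⟩ := pow_unbounded_of_one_lt (C / ε')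
      (show (1 : ℝ) < p by exact_mod_cast hp.one_lt)
    refine ⟨s, ?_⟩
    rw [div_lt_iff₀ hε'0] at hs
    push_cast
    linarith
  set P := p ^ s with hPdef
  have hP : 0 < P := pow_pos hp.pos s
  obtain ⟨R, hR⟩ := hμ.exists_norm_integral_le hE hgood (P := P) hP hc₀ hε'0
  have key := exists_sum_range_le (a := fun n => ‖∫ x, F ((linCA η ρ)^[n] x) ∂μ‖)
    (fun n => norm_nonneg _) (fun n => ?_) hp (j := R) hP hε'0 hs fun n m _ hCm hcard => ?_
  · obtain ⟨B, hB⟩ := key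
    refine ⟨B, fun N => (hB N).trans_eq ?_⟩
    rw [hε']
    ring
  · refine (norm_integral_le_of_norm_le_const (C := 1) (ae_of_all _ fun x => (hF _).le)).trans ?_
    simp
  · set N := m + P * n with hN
    set D : ℤ := P - (a - q) with hD
    rw [← integral_shift hgood.2.1 (fun x => F ((linCA η ρ)^[N] x)) D]
    refine hR (b + N + D).toNat (fun x => F ((linCA η ρ)^[N] fun i => x (i + D)))
      (fun x => (hF _).le) (fun x y => ?_) (fun x y hxy => ?_) (unitBinomials p n)
      ((Nat.lt_two_pow_self (n := R)).le.trans hcard) fun k hk => ?_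
    · rw [← hmul, ← linCA_iterate_add]
      rfl
    · refine hdep _ _ (linCA_iterate_congr η ρ fun i h1 h2 => hxy _ ?_ ?_)
      · omega
      · omega
    · obtain ⟨h, hsupp, hh⟩ := hblock s m n k (by rw [← hPdef]; omega) (mem_unitBinomials.mp hk)
      refine ⟨fun i => h.1 (i - D), mem_TMC_add_iff hK fun i => ?_, fun i hi => ?_, ?_⟩
      · have := h.2 (i - D)
        rwa [show i - D + 1 = i + 1 - D by ring] at this
      · obtain ⟨h1, h2⟩ := hsupp _ hi
        rw [← hPdef] at h1 h2
        constructor <;> nlinarith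
      · refine hFroot _ fun h1 => hh ((hχ _).mpr ?_)
        rw [coe_linEnd_pow]
        simpa only [add_sub_cancel_right] using h1

end Characters

section Convergence

variable {G : Type*} [Fintype G] [AddCommGroup G] [TopologicalSpace G] [DiscreteTopology G]
  [MeasurableSpace G] [MeasurableSingletonClass G] {E : Set (G × G)} {K : AddSubgroup (G × G)}
  {g : G} {μ κ : Measure (ℤ → G)}

theorem tendsto_cesaro_of_mul (hE : EveryLetterOccurs E)
    (hgood : GoodMeasure E μ) (hμ : CCSD E μ) (hK : ∀ a b, (a, b) ∈ K ↔ (g + a, g + b) ∈ E)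
    {q : ℕ} (hq : ConnectsToZero K q) {φ : G → G → G} (hSC : SC E φ) {η ρ : G ≃+ G} {c : G}
    (hφ : ∀ a b, φ a b = η a + ρ b + c) (hη : ∀ a b, (η a, η b) ∈ K ↔ (a, b) ∈ K)
    (hρ : ∀ a b, (ρ a, ρ b) ∈ K ↔ (a, b) ∈ K) (hcomm : ∀ a, η (ρ a) = ρ (η a))
    [IsProbabilityMeasure κ] (hT : ∀ᵐ x ∂κ, x ∈ TMC E)
    (htr : ∀ h ∈ pathSubgroup K, MeasurePreserving (fun x => x + h) κ κ)
    {F : (ℤ → G) → ℂ} (hFc : Continuous F) (hF : ∀ x, ‖F x‖ = 1)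
    (hmul : ∀ x y, F (x + y) = F x * F y) {a b : ℤ}
    (hab : a < b) (hdep : ∀ x y, (∀ i, a ≤ i → i < b → x i = y i) → F x = F y) :
    Tendsto (fun N : ℕ => (N : ℂ)⁻¹ * ∑ n ∈ Finset.range N, ∫ x, F ((CA φ)^[n] x) ∂μ) atTop
      (𝓝 (∫ x, F x ∂κ)) := by
  have := borelSpace_of_finite_discrete (G := G)
  have hprob := hgood.1
  by_cases hne : ∃ h ∈ pathSubgroup K, F h ≠ 1
  · have hzero : ∫ x, F x ∂κ = 0 := by
      obtain ⟨h, hh, hh1⟩ := hne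
      have h1 : ∫ x, F (x + h) ∂κ = ∫ x, F x ∂κ := by
        conv_rhs => rw [← (htr h hh).map_eq]
        exact (integral_map (htr h hh).aemeasurable
          (hFc.aestronglyMeasurable)).symm
      simp only [hmul] at h1
      rw [integral_mul_const] at h1
      have h2 : (∫ x, F x ∂κ) * (F h - 1) = 0 := by rw [mul_sub, h1, mul_one, sub_self]
      exact (mul_eq_zero.mp h2).resolve_right (sub_ne_zero.mpr hh1)
    rw [hzero]
    refine tendsto_cesaro_zero fun ε hε => ?_
    obtain ⟨B, hB⟩ := exists_sum_norm_integral_le hE hgood hμ hK hq hη hρ hcomm hF hmul hab hdep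
      hne hε
    refine ⟨B, fun N => (hB N).trans' (Finset.sum_le_sum fun n _ => le_of_eq ?_)⟩
    have hsplit : ∀ x, F ((CA φ)^[n] x) = F ((linCA η ρ)^[n] x) * F ((CA φ)^[n] 0) := fun x => by
      rw [CA_iterate_eq_linCA_iterate_add η ρ hφ n x, hmul]
    rw [integral_congr_ae (ae_of_all _ hsplit), integral_mul_const, norm_mul, hF, mul_one]
  · push Not at hne
    have hconst : ∀ x ∈ TMC E, F x = F fun _ => g := fun x hx => by
      rw [← mul_one (F fun _ => g), ← hne _ ((mem_TMC_iff_sub_mem hK).mp hx), ← hmul]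
      congr 1
      ext i
      simp
    have hμT : ∀ᵐ x ∂μ, x ∈ TMC E :=
      (mem_ae_iff_prob_eq_one (measurableSet_TMC E)).mpr hgood.2.2.1
    have h1 : ∀ n, ∫ x, F ((CA φ)^[n] x) ∂μ = F fun _ => g := fun n => by
      rw [integral_congr_ae (g := fun _ => F fun _ => g)
        (hμT.mono fun x hx => hconst _ (CA_iterate_mem_TMC hSC n hx))]
      simp
    have h2 : ∫ x, F x ∂κ = F fun _ => g := by
      rw [integral_congr_ae (g := fun _ => F fun _ => g) (hT.mono fun x hx => hconst _ hx)]
      simp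
    rw [h2]
    refine tendsto_const_nhds.congr' ?_
    filter_upwards [eventually_ne_atTop 0] with N hN
    simp only [h1, Finset.sum_const, Finset.card_range, nsmul_eq_mul]
    rw [inv_mul_cancel_left₀ (by exact_mod_cast hN)]

/-- Convergence for characters implies convergence for functions of finitely many coordinates. -/
theorem tendsto_cesaro_of_window [IsProbabilityMeasure μ] [IsProbabilityMeasure κ]
    {Φ : (ℤ → G) → ℤ → G} (hΦ : Continuous Φ) (s : Finset ℤ)
    (hchar : ∀ ψ : AddChar (s → G) ℂ, Tendsto (fun N : ℕ =>
      (N : ℂ)⁻¹ * ∑ n ∈ Finset.range N, ∫ x, ψ (s.restrict (Φ^[n] x)) ∂μ) atTop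
      (𝓝 (∫ x, ψ (s.restrict x) ∂κ)))
    {f : (ℤ → G) → ℝ} (hf : ∀ x y, (∀ i ∈ s, x i = y i) → f x = f y) :
    Tendsto (fun N : ℕ => (N : ℝ)⁻¹ * ∑ n ∈ Finset.range N, ∫ x, f (Φ^[n] x) ∂μ) atTop
      (𝓝 (∫ x, f x ∂κ)) := by
  classical
  have := borelSpace_of_finite_discrete (G := G)
  let u : (s → G) → ℂ := fun w => f fun i => if h : i ∈ s then w ⟨i, h⟩ else 0
  have hu : ∀ x, (f x : ℂ) = ∑ ψ, (AddChar.complexBasis (s → G)).repr u ψ * ψ (s.restrict x) :=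
    fun x => by
      have h1 := congrFun ((AddChar.complexBasis (s → G)).sum_repr u) (s.restrict x)
      simp only [AddChar.complexBasis_apply, Fintype.sum_apply, Pi.smul_apply, smul_eq_mul] at h1
      rw [h1]
      exact congrArg _ (hf _ _ fun i hi => by simp [hi])
  have hcont : ∀ ψ : AddChar (s → G) ℂ, Continuous fun x : ℤ → G => ψ (s.restrict x) := fun ψ =>
    (continuous_of_discreteTopology (f := ψ)).comp
      (continuous_pi fun i : s => continuous_apply (i : ℤ))
  have hintble : ∀ (m : Measure (ℤ → G)) [IsProbabilityMeasure m] (ψ : AddChar (s → G) ℂ) (n : ℕ),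
      Integrable (fun x => ψ (s.restrict (Φ^[n] x))) m := fun m _ ψ n =>
    ((hcont ψ).comp (hΦ.iterate n)).integrable_of_hasCompactSupport
      (HasCompactSupport.of_compactSpace _)
  have hI : ∀ (m : Measure (ℤ → G)) [IsProbabilityMeasure m] (n : ℕ),
      ((∫ x, f (Φ^[n] x) ∂m : ℝ) : ℂ) = ∑ ψ, (AddChar.complexBasis (s → G)).repr u ψ *
        ∫ x, ψ (s.restrict (Φ^[n] x)) ∂m := fun m _ n => by
    rw [← integral_complex_ofReal]
    simp only [hu]
    rw [integral_finsetSum _ fun ψ _ => (hintble m ψ n).const_mul _]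
    exact Finset.sum_congr rfl fun ψ _ => integral_const_mul _ _
  have hlim := tendsto_finsetSum Finset.univ fun (ψ : AddChar (s → G) ℂ) _ =>
    (hchar ψ).const_mul ((AddChar.complexBasis (s → G)).repr u ψ)
  have hκ := hI κ 0
  simp only [Function.iterate_zero, id] at hκ
  rw [← hκ] at hlim
  have hre := (Complex.continuous_re.tendsto _).comp hlim
  rw [Complex.ofReal_re] at hre
  refine hre.congr fun N => ?_
  rw [Function.comp_apply, ← Complex.ofReal_re ((N : ℝ)⁻¹ * _)]
  congr 1
  push_cast
  simp only [hI μ]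
  rw [Finset.sum_comm, Finset.mul_sum]
  refine Finset.sum_congr rfl fun ψ _ => ?_
  rw [← Finset.mul_sum]
  ring

/-- The continuous functions depending on finitely many coordinates. -/
def windowSubalgebra (G : Type*) [TopologicalSpace G] : Subalgebra ℝ C(ℤ → G, ℝ) where
  carrier := {f | ∃ s : Finset ℤ, ∀ x y, (∀ i ∈ s, x i = y i) → f x = f y}
  mul_mem' := by
    rintro f f' ⟨s, hs⟩ ⟨s', hs'⟩
    classical
    refine ⟨s ∪ s', fun x y h => ?_⟩
    rw [ContinuousMap.mul_apply, ContinuousMap.mul_apply,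
      hs x y fun i hi => h i (Finset.mem_union_left _ hi),
      hs' x y fun i hi => h i (Finset.mem_union_right _ hi)]
  add_mem' := by
    rintro f f' ⟨s, hs⟩ ⟨s', hs'⟩
    classical
    refine ⟨s ∪ s', fun x y h => ?_⟩
    rw [ContinuousMap.add_apply, ContinuousMap.add_apply,
      hs x y fun i hi => h i (Finset.mem_union_left _ hi),
      hs' x y fun i hi => h i (Finset.mem_union_right _ hi)]
  algebraMap_mem' r := ⟨∅, fun _ _ _ => rfl⟩

theorem separatesPoints_windowSubalgebra : (windowSubalgebra G).SeparatesPoints := by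
  classical
  intro x y hxy
  obtain ⟨i, hi⟩ := Function.ne_iff.mp hxy
  refine ⟨_, ⟨⟨fun z => if z i = x i then 1 else 0,
    (continuous_of_discreteTopology (f := fun t : G => if t = x i then (1 : ℝ) else 0)).comp
      (continuous_apply i)⟩, ⟨{i}, fun z z' h => ?_⟩, rfl⟩, ?_⟩
  · simp [h i (Finset.mem_singleton_self i)]
  · simp [Ne.symm hi]

theorem cesaroTendstoTo_of_windowSubalgebra [IsProbabilityMeasure μ] [IsProbabilityMeasure κ]
    {Φ : (ℤ → G) → ℤ → G} (hΦ : Continuous Φ)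
    (h : ∀ f ∈ windowSubalgebra G, Tendsto
      (fun N : ℕ => (N : ℝ)⁻¹ * ∑ n ∈ Finset.range N, ∫ x, f (Φ^[n] x) ∂μ) atTop
      (𝓝 (∫ x, f x ∂κ))) : CesaroTendstoTo μ Φ κ := by
  have := borelSpace_of_finite_discrete (G := G)
  intro f
  have hintble : ∀ (m : Measure (ℤ → G)) [IsProbabilityMeasure m] (f : C(ℤ → G, ℝ)) (n : ℕ),
      Integrable (fun x => f (Φ^[n] x)) m := fun m _ f n =>
    (f.continuous.comp (hΦ.iterate n)).integrable_of_hasCompactSupport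
      (HasCompactSupport.of_compactSpace _)
  have hclose : ∀ (m : Measure (ℤ → G)) [IsProbabilityMeasure m] (f f' : C(ℤ → G, ℝ)) (n : ℕ),
      |∫ x, f (Φ^[n] x) ∂m - ∫ x, f' (Φ^[n] x) ∂m| ≤ ‖f - f'‖ := fun m _ f f' n => by
    rw [← integral_sub (hintble m f n) (hintble m f' n), ← Real.norm_eq_abs]
    refine (norm_integral_le_of_norm_le_const (C := ‖f - f'‖)
      (ae_of_all _ fun x => (f - f').norm_coe_le_norm _)).trans ?_
    simp
  have hmean : ∀ (f f' : C(ℤ → G, ℝ)) (N : ℕ),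
      |(N : ℝ)⁻¹ * ∑ n ∈ Finset.range N, ∫ x, f (Φ^[n] x) ∂μ -
        (N : ℝ)⁻¹ * ∑ n ∈ Finset.range N, ∫ x, f' (Φ^[n] x) ∂μ| ≤ ‖f - f'‖ := fun f f' N => by
    rw [← mul_sub, ← Finset.sum_sub_distrib, abs_mul, abs_of_nonneg (by positivity)]
    rcases N.eq_zero_or_pos with rfl | hN
    · simp
    rw [inv_mul_le_iff₀ (by exact_mod_cast hN)]
    refine (Finset.abs_sum_le_sum_abs _ _).trans
      ((Finset.sum_le_sum fun n _ => hclose μ f f' n).trans_eq ?_)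
    simp
  rw [Metric.tendsto_atTop]
  intro ε hε
  obtain ⟨⟨f', hf'⟩, hff⟩ := ContinuousMap.exists_mem_subalgebra_near_continuousMap_of_separatesPoints
    (windowSubalgebra G) separatesPoints_windowSubalgebra f (ε / 3) (by positivity)
  obtain ⟨N₀, hN₀⟩ := Metric.tendsto_atTop.mp (h f' hf') (ε / 3) (by positivity)
  refine ⟨N₀, fun N hN => ?_⟩
  have h1 := hmean f' f N
  have h2 := hclose κ f' f 0
  have h3 := hN₀ N hN
  simp only [Function.iterate_zero, id] at h2
  rw [Real.dist_eq] at h3 ⊢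
  rw [abs_le] at h1 h2
  rw [abs_lt] at h3 ⊢
  dsimp only at hff
  constructor <;> linarith

end Convergence

end CAStmt

/-- Theorem (i), particular case: for an irreducible TMC with a constant
sequence, the Cesàro means converge to the Parry measure. -/
theorem CAStmt.stmt15 {G : Type} [Fintype G] [AddCommGroup G]
    [TopologicalSpace G] [DiscreteTopology G]
    [MeasurableSpace G] [MeasurableSingletonClass G]
    (E : Set (G × G)) (hE : EveryLetterOccurs E)
    (φ : G → G → G) (hSC : SC E φ)
    (η ρa : G ≃+ G) (hcomm : ∀ a, η (ρa a) = ρa (η a)) (c : G)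
    (hφ : ∀ a b, φ a b = η a + ρa b + c)
    (hRS : RegularSimple E φ)
    (hirr : IrreducibleTMC E) (hconst : ∃ g : G, (fun _ : ℤ => g) ∈ TMC E)
    (μ : Measure (ℤ → G)) (hgood : GoodMeasure E μ) (hccsd : CCSD E μ) :
    ∃ κ : Measure (ℤ → G), IsParryMeasure E κ ∧ CesaroTendstoTo μ (CA φ) κ := by
  obtain ⟨g, hgT⟩ := hconst
  have hg : (g, g) ∈ E := hgT 0
  have hprob := hgood.1
  obtain ⟨K, hK, hη, hρ⟩ := exists_edge_subgroup hE hSC η ρa c hφ hg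
  obtain ⟨q, hq⟩ := exists_connectsToZero hirr hg hK
  obtain ⟨κ, hκ, hshift, hsupp, htr⟩ := exists_coset_haar K g
  have hT : ∀ᵐ x ∂κ, x ∈ TMC E := hsupp.mono fun x hx => (mem_TMC_iff_sub_mem hK).mpr hx
  refine ⟨κ, isParryMeasure_of_invariant hE hg hK hshift hT htr,
    cesaroTendstoTo_of_windowSubalgebra (continuous_CA φ) ?_⟩
  rintro f ⟨s, hs⟩
  refine tendsto_cesaro_of_window (continuous_CA φ) s (fun ψ => ?_) hs
  obtain ⟨b, hb⟩ := s.finite_toSet.bddAbove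
  obtain ⟨a, ha⟩ := s.finite_toSet.bddBelow
  refine tendsto_cesaro_of_mul hE hgood hccsd hK hq hSC hφ hη hρ hcomm hT htr
    (F := fun x => ψ (s.restrict x)) (a := min a b) (b := b + 1) ?_ (fun x => ψ.norm_apply _)
    (fun x y => ψ.map_add_eq_mul _ _) (by omega) fun x y hxy => ?_
  · exact (continuous_of_discreteTopology (f := ψ)).comp
      (continuous_pi fun i : s => continuous_apply (i : ℤ))
  · refine congrArg ψ (funext fun i => hxy i ?_ ?_)
    · exact (min_le_left _ _).trans (ha i.2)
    · exact Int.lt_add_one_of_le (hb i.2)
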